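/- The n-string braid group of the 3-star S_3 is a free group of rank n choose 2: B_n(S_3, c) ≅ F_{\binom{n}{2}}. -/

import Mathlib

open Set CategoryTheory Complex

open scoped Real

noncomputable section

/-- Ordered configuration space: injective `n`-tuples in `X`
    (the complement of the fat diagonal in `X^n`), with the subspace topology. -/
def OrdConf (n : ℕ) (X : Type*) [TopologicalSpace X] : Type _ :=
  {f : Fin n → X // Function.Injective f}

instance (n : ℕ) (X : Type*) [TopologicalSpace X] : TopologicalSpace (OrdConf n X) :=
  instTopologicalSpaceSubtype

/-- The unordered `n`-point configuration space `U_n^{top}(X)`: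
    the set of `n`-element subsets of `X`. -/
def UConf (n : ℕ) (X : Type*) [TopologicalSpace X] : Type _ :=
  {s : Set X // s.Finite ∧ s.ncard = n}

/-- The natural projection `p : X^n - Δ → U_n^{top}(X)`, `(x_1,…,x_n) ↦ {x_1,…,x_n}`. -/
def confProj (n : ℕ) (X : Type*) [TopologicalSpace X] : OrdConf n X → UConf n X :=
  fun f => ⟨Set.range f.1, Set.finite_range _, by
    rw [← Set.image_univ, Set.ncard_image_of_injective _ f.2, Set.ncard_univ,
      Nat.card_eq_fintype_card, Fintype.card_fin]⟩

/-- `U_n^{top}(X)` carries the quotient topology from `p`. -/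
instance (n : ℕ) (X : Type*) [TopologicalSpace X] : TopologicalSpace (UConf n X) :=
  TopologicalSpace.coinduced (confProj n X) inferInstance

/-- The 3-star `S₃ ⊆ ℂ`: three unit segments from the origin at angles `2πj/3`. -/
def threeStar : Set ℂ :=
  ⋃ j ∈ Finset.range 3,
    {z | ∃ r : ℝ, 0 ≤ r ∧ r ≤ 1 ∧ z = (r : ℂ) * Complex.exp (2 * Real.pi * j / 3 * Complex.I)}

section PathTransport

open Path

variable {X : Type*} [TopologicalSpace X] {c : X}

/-- A family of homotopy classes of paths to `c` which is invariant under transport along paths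
contained in `U`. -/
def IsPathTransport (U : Set X) (σ : ∀ x, Homotopic.Quotient x c) : Prop :=
  ∀ ⦃x y : X⦄ (p : Path x y), (∀ t, p t ∈ U) → (Homotopic.Quotient.mk p).trans (σ y) = σ x

/-- The loop comparing two path classes with the same endpoints. -/
def pathDiff {x : X} (p q : Homotopic.Quotient x c) : FundamentalGroup X c :=
  q.symm.trans p

theorem pathDiff_eq_iff {x : X} {p q : Homotopic.Quotient x c} {g : FundamentalGroup X c} :
    pathDiff p q = g ↔ q.trans g = p := by
  constructor
  · rintro rfl
    simp [pathDiff, ← Homotopic.Quotient.trans_assoc]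
  · rintro rfl
    simp [pathDiff, ← Homotopic.Quotient.trans_assoc]

theorem trans_pathDiff {x : X} (p q : Homotopic.Quotient x c) : q.trans (pathDiff p q) = p :=
  pathDiff_eq_iff.1 rfl

theorem pathDiff_self {x : X} (p : Homotopic.Quotient x c) : pathDiff p p = 1 :=
  pathDiff_eq_iff.2 (Homotopic.Quotient.trans_refl p)

theorem pathDiff_mul {x : X} (p q r : Homotopic.Quotient x c) :
    pathDiff p q * pathDiff q r = pathDiff p r := by
  symm
  rw [pathDiff_eq_iff, FundamentalGroup.mul_def, ← Homotopic.Quotient.trans_assoc,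
    trans_pathDiff, trans_pathDiff]

theorem pathDiff_inv {x : X} (p q : Homotopic.Quotient x c) : (pathDiff p q)⁻¹ = pathDiff q p := by
  rw [inv_eq_iff_mul_eq_one, pathDiff_mul, pathDiff_self]

theorem pathDiff_trans {x y : X} (r : Homotopic.Quotient y x) (p q : Homotopic.Quotient x c) :
    pathDiff (r.trans p) (r.trans q) = pathDiff p q := by
  rw [pathDiff_eq_iff, Homotopic.Quotient.trans_assoc, trans_pathDiff]

theorem pathDiff_trans_trans {x : X} (p q : Homotopic.Quotient x c) (u w : FundamentalGroup X c) :
    pathDiff (p.trans u) (q.trans w) = u * pathDiff p q * w⁻¹ := by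
  rw [pathDiff_eq_iff, FundamentalGroup.mul_def, FundamentalGroup.mul_def,
    FundamentalGroup.inv_def, Homotopic.Quotient.trans_assoc, ← Homotopic.Quotient.trans_assoc w]
  simp [← Homotopic.Quotient.trans_assoc, trans_pathDiff]

theorem IsPathTransport.trans {U : Set X} {σ : ∀ x, Homotopic.Quotient x c}
    (h : IsPathTransport U σ) (u : FundamentalGroup X c) :
    IsPathTransport U fun x => (σ x).trans u := fun x y p hp => by
  rw [← Homotopic.Quotient.trans_assoc, h p hp]

theorem IsPathTransport.pathDiff_eq {U V : Set X} {σ τ : ∀ x, Homotopic.Quotient x c}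
    (hσ : IsPathTransport U σ) (hτ : IsPathTransport V τ) {x y : X}
    (h : JoinedIn (U ∩ V) x y) : pathDiff (σ x) (τ x) = pathDiff (σ y) (τ y) := by
  obtain ⟨p, hp⟩ := h
  rw [← hσ p fun t => (hp t).1, ← hτ p fun t => (hp t).2, pathDiff_trans]

theorem IsSimplyConnected.exists_isPathTransport [PathConnectedSpace X] {U : Set X}
    (hU : IsSimplyConnected U) (c : X) :
    ∃ σ : ∀ x, Homotopic.Quotient x c, IsPathTransport U σ := by
  classical
  obtain ⟨u, hu⟩ := hU.nonempty
  have hj : ∀ x ∈ U, JoinedIn U x u := fun x hx => hU.isPathConnected.joinedIn x hx u hu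
  refine ⟨fun x => if hx : x ∈ U then
    (Homotopic.Quotient.mk (hj x hx).somePath).trans (.mk (PathConnectedSpace.somePath u c))
    else .mk (PathConnectedSpace.somePath x c), fun x y p hp => ?_⟩
  have hx : x ∈ U := by simpa using hp 0
  have hy : y ∈ U := by simpa using hp 1
  simp only [hx, hy, dif_pos, ← Homotopic.Quotient.trans_assoc]
  congr 1
  rw [← Homotopic.Quotient.mk_trans, Homotopic.Quotient.eq]
  have := hU.simplyConnectedSpace
  have lift : ∀ {a b : X} (q : Path a b) (hq : ∀ t, q t ∈ U) (ha : a ∈ U) (hb : b ∈ U),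
      ∃ q' : Path (⟨a, ha⟩ : U) ⟨b, hb⟩, q'.map continuous_subtype_val = q := fun q hq ha hb =>
    ⟨⟨⟨fun t => ⟨q t, hq t⟩, by fun_prop⟩, by simp, by simp⟩, by ext; rfl⟩
  obtain ⟨p', hp'⟩ := lift p hp hx hy
  obtain ⟨q', hq'⟩ := lift _ (hj y hy).somePath_mem hy hu
  obtain ⟨r', hr'⟩ := lift _ (hj x hx).somePath_mem hx hu
  rw [← hp', ← hq', ← hr', ← Path.map_trans]
  exact (SimplyConnectedSpace.paths_homotopic (p'.trans q') r').map ⟨_, continuous_subtype_val⟩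

/-- The fundamental group is generated by the transition loops of an open cover with path
transports. -/
theorem mem_of_pathDiff_mem {ι : Type*} {U : ι → Set X} (hU : ∀ i, IsOpen (U i))
    (hcov : ∀ x, ∃ i, x ∈ U i) {σ : ι → ∀ x, Homotopic.Quotient x c}
    (hσ : ∀ i, IsPathTransport (U i) (σ i)) (H : Subgroup (FundamentalGroup X c))
    (hH : ∀ i j, ∀ x ∈ U i ∩ U j, pathDiff (σ i x) (σ j x) ∈ H) (g : FundamentalGroup X c) :
    g ∈ H := by
  have key : ∀ {x y : X} (p : Path x y) (i j : ι), x ∈ U i → y ∈ U j →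
      pathDiff ((Homotopic.Quotient.mk p).trans (σ j y)) (σ i x) ∈ H := by
    intro x y p
    obtain ⟨t, ht0, htm, ⟨n, hn⟩, ht⟩ := exists_monotone_Icc_subset_open_cover_unitInterval
      (fun i => (hU i).preimage p.continuous) fun s _ => mem_iUnion.2 (hcov (p s))
    have step : ∀ (m : ℕ) (i j : ι), p (t 0) ∈ U i → p (t m) ∈ U j →
        pathDiff ((Homotopic.Quotient.mk (p.subpath (t 0) (t m))).trans (σ j _)) (σ i _) ∈ H := by
      intro m
      induction m with
      | zero =>
        intro i j hi hj
        simpa using hH j i _ ⟨hj, hi⟩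
      | succ m ih =>
        intro i j hi hj
        obtain ⟨k, hk⟩ := ht m
        have hle := htm (Nat.le_succ m)
        have h1 := ih i k hi (hk ⟨le_rfl, hle⟩)
        have h2 : (Homotopic.Quotient.mk (p.subpath (t m) (t (m + 1)))).trans (σ k _) = σ k _ :=
          hσ k _ fun s => by
            have hs : p.subpath (t m) (t (m + 1)) s ∈ range (p.subpath (t m) (t (m + 1))) := ⟨s, rfl⟩
            rw [Path.range_subpath_of_le _ _ _ hle] at hs
            obtain ⟨r, hr, hrs⟩ := hs
            exact hrs ▸ hk hr
        have h3 := hH j k _ ⟨hj, hk ⟨hle, le_rfl⟩⟩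
        have h4 : Homotopic.Quotient.mk (p.subpath (t 0) (t (m + 1))) =
            (Homotopic.Quotient.mk (p.subpath (t 0) (t m))).trans
              (.mk (p.subpath (t m) (t (m + 1)))) := by
          rw [← Homotopic.Quotient.mk_trans, Homotopic.Quotient.eq]
          exact ⟨(Path.Homotopy.subpathTransSubpath p _ _ _).symm⟩
        rw [← h2] at h1
        rw [h4]
        rw [← pathDiff_trans ((Homotopic.Quotient.mk (p.subpath (t 0) (t m))).trans
              (.mk (p.subpath (t m) (t (m + 1)))))] at h3
        rw [← Homotopic.Quotient.trans_assoc] at h1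
        have := H.mul_mem h3 h1
        rwa [pathDiff_mul] at this
    have h5 : ∀ (a b : unitInterval), a = 0 → b = 1 → (∀ i j, p a ∈ U i → p b ∈ U j →
        pathDiff ((Homotopic.Quotient.mk (p.subpath a b)).trans (σ j _)) (σ i _) ∈ H) →
        ∀ (i j : ι), x ∈ U i → y ∈ U j →
          pathDiff ((Homotopic.Quotient.mk p).trans (σ j y)) (σ i x) ∈ H := by
      rintro a b rfl rfl h i j hi hj
      have h6 := h i j (by simpa using hi) (by simpa using hj)
      rw [Path.subpath_zero_one] at h6
      have : ∀ (x' y' : X) (hx : x' = x) (hy : y' = y),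
          pathDiff ((Homotopic.Quotient.mk (p.cast hx hy)).trans (σ j y')) (σ i x') ∈ H →
          pathDiff ((Homotopic.Quotient.mk p).trans (σ j y)) (σ i x) ∈ H := by
        rintro x' y' rfl rfl h
        simpa using h
      exact this _ _ _ _ h6
    exact h5 _ _ ht0 (hn n le_rfl) (step n)
  obtain ⟨i, hi⟩ := hcov c
  let s : FundamentalGroup X c := σ i c
  have conj : ∀ g : FundamentalGroup X c, s * g * s⁻¹ ∈ H := by
    intro g
    induction g using Homotopic.Quotient.ind with | mk g =>
    exact key g i i hi hi
  have h := conj (s⁻¹ * g * s)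
  rwa [mul_assoc, mul_assoc, mul_inv_cancel, mul_one, mul_inv_cancel_left] at h

end PathTransport

section Monodromy

open Path Bundle

universe u v

variable {X : Type u} [TopologicalSpace X] {c : X}

/-- The fiber bundle core with discrete fiber `G` whose coordinate changes are left
multiplications by a locally constant cocycle. -/
def cocycleCore {ι G : Type*} [Group G] [TopologicalSpace G] [DiscreteTopology G] {U : ι → Set X}
    (hU : ∀ i, IsOpen (U i)) (hcov : ∀ x, ∃ i, x ∈ U i) (t : ι → ι → G) (ht : ∀ i, t i i = 1)
    (htt : ∀ i j k, (U i ∩ U j ∩ U k).Nonempty → t i j * t j k = t i k) :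
    FiberBundleCore ι X G where
  baseSet := U
  isOpen_baseSet := hU
  indexAt x := (hcov x).choose
  mem_baseSet_at x := (hcov x).choose_spec
  coordChange i j _ g := t j i * g
  coordChange_self i x _ v := by simp [ht]
  continuousOn_coordChange i j := by
    have : Continuous fun g : G => t j i * g := continuous_of_discreteTopology
    exact (this.comp continuous_snd).continuousOn
  coordChange_comp i j k x hx v := by
    rw [← mul_assoc, htt k j i ⟨x, ⟨hx.2, hx.1.2⟩, hx.1.1⟩]

/-- Every locally constant cocycle on an open cover is realised by a permutation action of the
fundamental group. -/
theorem exists_monodromy_of_cocycle {ι : Type*} {G : Type v} [Group G] {U : ι → Set X}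
    (hU : ∀ i, IsOpen (U i)) (hcov : ∀ x, ∃ i, x ∈ U i) {σ : ι → ∀ x, Homotopic.Quotient x c}
    (hσ : ∀ i, IsPathTransport (U i) (σ i)) (hpc : ∀ i, (U i).Nonempty → IsPathConnected (U i))
    (t : ι → ι → G) (ht : ∀ i, t i i = 1)
    (htt : ∀ i j k, (U i ∩ U j ∩ U k).Nonempty → t i j * t j k = t i k) :
    ∃ (T : Type (max u v)) (M : FundamentalGroup X c →* Equiv.Perm T) (m : ι → G → T),
      (∀ i, (U i).Nonempty → Function.Injective (m i)) ∧
      ∀ i j, ∀ x ∈ U i ∩ U j, ∀ g, M (pathDiff (σ i x) (σ j x)) (m j g) = m i (t i j * g) := by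
  classical
  let _ : TopologicalSpace G := ⊥
  have : DiscreteTopology G := ⟨rfl⟩
  let Z := cocycleCore hU hcov t ht htt
  have cov : IsCoveringMap (π G Z.Fiber) := FiberBundle.isCoveringMap
  let e (i : ι) (x : X) (g : G) : π G Z.Fiber ⁻¹' {x} :=
    ⟨(Z.localTriv i).toOpenPartialHomeomorph.symm (x, g), rfl⟩
  have e_inj : ∀ i x, Function.Injective (e i x) := by
    intro i x g h hgh
    have := congrArg Subtype.val hgh
    simp only [e, FiberBundleCore.localTriv_symm_apply] at this
    exact mul_left_cancel (TotalSpace.mk_injective x this)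
  have e_change : ∀ i j x g, x ∈ U i → x ∈ U j → e j x g = e i x (t i j * g) := by
    intro i j x g hi hj
    apply Subtype.ext
    simp only [e, FiberBundleCore.localTriv_symm_apply]
    congr 1
    have hk : x ∈ U (Z.indexAt x) := Z.mem_baseSet_at x
    change t _ j * g = t _ i * (t i j * g)
    rw [← mul_assoc, htt _ i j ⟨x, ⟨hk, hi⟩, hj⟩]
  have e_path : ∀ i {x y : X} (p : Path x y) g, (∀ s, p s ∈ U i) →
      cov.monodromy (Homotopic.Quotient.mk p) (e i x g) = e i y g := by
    intro i x y p g hp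
    let q : Path (e i x g : Z.TotalSpace) (e i y g) :=
      { toFun := fun s => e i (p s) g
        continuous_toFun := by
          refine (Z.localTriv i).toOpenPartialHomeomorph.continuousOn_symm.comp_continuous
            (f := fun s => (p s, g)) (by fun_prop) fun s => ?_
          rw [FiberBundleCore.mem_localTriv_target]
          exact hp s
        source' := by rw [p.source]
        target' := by rw [p.target] }
    refine cov.monodromy_eq_of_map_eq (.mk q) ?_
    rfl
  let m (i : ι) (g : G) : π G Z.Fiber ⁻¹' {c} :=
    if h : (U i).Nonempty then cov.monodromy (σ i h.some) (e i h.some g)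
    else e i c g
  have m_eq : ∀ i x g, x ∈ U i → m i g = cov.monodromy (σ i x) (e i x g) := by
    intro i x g hx
    have h : (U i).Nonempty := ⟨x, hx⟩
    obtain ⟨p, hp⟩ := (hpc i h).joinedIn _ h.some_mem x hx
    simp only [m, dif_pos h]
    rw [← hσ i p hp, cov.monodromy_trans_apply, e_path i p g hp]
  refine ⟨_, cov.monodromyPerm c, m, ?_, ?_⟩
  · rintro i ⟨x, hx⟩ g h hgh
    rw [m_eq i x g hx, m_eq i x h hx] at hgh
    exact e_inj i x ((cov.monodromy_bijective _).1 hgh)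
  · rintro i j x ⟨hi, hj⟩ g
    rw [m_eq i x _ hi, m_eq j x _ hj, IsCoveringMap.coe_monodromyPerm,
      ← e_change i j x g hi hj]
    rw [← cov.monodromy_trans_apply, trans_pathDiff]

end Monodromy

section TriangularCover

open Path

/-- The gauge trivialising the edges of the standard spanning tree of the triangular graph. -/
def treeGauge {P : Type*} [Group P] (k₀ k₁ k₂ : ℕ → ℕ → P) : ℕ → ℕ → P
  | 0, 0 => 1
  | 0, c + 1 => treeGauge k₀ k₁ k₂ 0 c * k₁ 0 c * (k₂ 0 c)⁻¹
  | a + 1, c => treeGauge k₀ k₁ k₂ a c * k₁ a c * (k₀ a c)⁻¹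

variable {X : Type*} [TopologicalSpace X]

/-- The cocycle on the triangular graph taking the values of the free generators on the edges
outside of the standard spanning tree. -/
def triangularCocycle (n : ℕ) :
    (ℕ × ℕ) ⊕ (ℕ × ℕ) → (ℕ × ℕ) ⊕ (ℕ × ℕ) → FreeGroup {p : ℕ × ℕ // 1 ≤ p.1 ∧ p.1 + p.2 < n}
  | .inl v, .inr y =>
    if h : (1 ≤ y.1 ∧ y.1 + y.2 < n) ∧ v = (y.1, y.2 + 1) then .of ⟨y, h.1⟩ else 1
  | .inr y, .inl v =>
    (if h : (1 ≤ y.1 ∧ y.1 + y.2 < n) ∧ v = (y.1, y.2 + 1) then .of ⟨y, h.1⟩ else 1)⁻¹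
  | .inl _, .inl _ => 1
  | .inr _, .inr _ => 1

/-- A space covered by simply connected open sets whose intersection pattern is the triangular
graph has free fundamental group. -/
theorem nonempty_mulEquiv_freeGroup_of_triangular_cover (n : ℕ) (A B : ℕ → ℕ → Set X)
    (hAo : ∀ a c, IsOpen (A a c)) (hBo : ∀ a c, IsOpen (B a c))
    (hcov : ∀ x, (∃ a c, x ∈ A a c) ∨ ∃ a c, x ∈ B a c)
    (hA : ∀ a c, a + c ≤ n → IsSimplyConnected (A a c))
    (hB : ∀ a c, a + c < n → IsSimplyConnected (B a c))
    (hA' : ∀ a c, (A a c).Nonempty → a + c ≤ n) (hB' : ∀ a c, (B a c).Nonempty → a + c < n)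
    (hAA : ∀ a c a' c', (A a c ∩ A a' c').Nonempty → a = a' ∧ c = c')
    (hBB : ∀ a c a' c', (B a c ∩ B a' c').Nonempty → a = a' ∧ c = c')
    (hAB : ∀ a c a' c', (A a c ∩ B a' c').Nonempty →
      (a = a' + 1 ∧ c = c') ∨ (a = a' ∧ c = c') ∨ (a = a' ∧ c = c' + 1))
    (h₀ : ∀ a c, a + c < n → IsPathConnected (A (a + 1) c ∩ B a c))
    (h₁ : ∀ a c, a + c < n → IsPathConnected (A a c ∩ B a c))
    (h₂ : ∀ a c, a + c < n → IsPathConnected (A a (c + 1) ∩ B a c)) (x₀ : X) :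
    Nonempty (FundamentalGroup X x₀ ≃* FreeGroup {p : ℕ × ℕ // 1 ≤ p.1 ∧ p.1 + p.2 < n}) := by
  classical
  have hpcX : PathConnectedSpace X := by
    obtain ⟨b, hb⟩ := (hA 0 0 (by omega)).nonempty
    have step : ∀ {S T : Set X}, IsPathConnected S → IsPathConnected T → (S ∩ T).Nonempty →
        (∀ x ∈ S, Joined b x) → ∀ x ∈ T, Joined b x := by
      rintro S T hS hT ⟨y, hyS, hyT⟩ h x hx
      exact (h y hyS).trans (hT.joinedIn y hyT x hx).joined
    have pA := fun a c h => (hA a c h).isPathConnected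
    have pB := fun a c h => (hB a c h).isPathConnected
    have AtoB : ∀ a c, a + c < n → (∀ x ∈ A a c, Joined b x) → ∀ x ∈ B a c, Joined b x :=
      fun a c h => step (pA a c (by omega)) (pB a c h) (h₁ a c h).nonempty
    have JA : ∀ a c, a + c ≤ n → ∀ x ∈ A a c, Joined b x := by
      intro a
      induction a with
      | zero =>
        intro c
        induction c with
        | zero => exact fun h x hx => ((pA 0 0 h).joinedIn b hb x hx).joined
        | succ c ih =>
          intro h
          exact step (pB 0 c (by omega)) (pA _ _ h) ((inter_comm _ _).symm ▸
            (h₂ 0 c (by omega)).nonempty) (AtoB 0 c (by omega) (ih (by omega)))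
      | succ a ih =>
        intro c h
        exact step (pB a c (by omega)) (pA _ _ h) ((inter_comm _ _).symm ▸
          (h₀ a c (by omega)).nonempty) (AtoB a c (by omega) (ih c (by omega)))
    have J : ∀ x, Joined b x := by
      intro x
      rcases hcov x with ⟨a, c, hx⟩ | ⟨a, c, hx⟩
      · exact JA a c (hA' a c ⟨x, hx⟩) x hx
      · have h := hB' a c ⟨x, hx⟩
        exact AtoB a c h (JA a c h.le) x hx
    exact ⟨⟨b⟩, fun x y => (J x).symm.trans (J y)⟩
  let U : (ℕ × ℕ) ⊕ (ℕ × ℕ) → Set X := Sum.elim (fun v => A v.1 v.2) fun y => B y.1 y.2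
  have hUo : ∀ i, IsOpen (U i) := by
    rintro (i | i)
    exacts [hAo _ _, hBo _ _]
  have hUcov : ∀ x, ∃ i, x ∈ U i := by
    intro x
    rcases hcov x with ⟨a, c, h⟩ | ⟨a, c, h⟩
    exacts [⟨.inl (a, c), h⟩, ⟨.inr (a, c), h⟩]
  have hUsc : ∀ i, (U i).Nonempty → IsSimplyConnected (U i) := by
    rintro (i | i) h
    exacts [hA _ _ (hA' _ _ h), hB _ _ (hB' _ _ h)]
  have hσ₀ : ∀ i, ∃ σ : ∀ x, Homotopic.Quotient x x₀, IsPathTransport (U i) σ := by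
    intro i
    by_cases h : (U i).Nonempty
    · exact (hUsc i h).exists_isPathTransport x₀
    · refine ⟨fun x => .mk (PathConnectedSpace.somePath x x₀), fun x y p hp => ?_⟩
      exact (h ⟨_, hp 0⟩).elim
  choose σ₀ hσ₀ using hσ₀
  -- the transition loops along the three kinds of edges, before fixing the gauge
  let k (v y : ℕ × ℕ) : FundamentalGroup X x₀ :=
    if h : (U (.inl v) ∩ U (.inr y)).Nonempty then
      pathDiff (σ₀ (.inl v) h.some) (σ₀ (.inr y) h.some) else 1
  let u : ℕ → ℕ → FundamentalGroup X x₀ := treeGauge (fun a c => k (a + 1, c) (a, c))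
    (fun a c => k (a, c) (a, c)) (fun a c => k (a, c + 1) (a, c))
  let γ : (ℕ × ℕ) ⊕ (ℕ × ℕ) → FundamentalGroup X x₀ :=
    Sum.elim (fun v => u v.1 v.2) fun y => u y.1 y.2 * k y y
  let σ (i) (x : X) : Homotopic.Quotient x x₀ := (σ₀ i x).trans (γ i)
  have hσ : ∀ i, IsPathTransport (U i) (σ i) := fun i => (hσ₀ i).trans _
  have hpcAB : ∀ v y : ℕ × ℕ, (U (.inl v) ∩ U (.inr y)).Nonempty →
      IsPathConnected (U (.inl v) ∩ U (.inr y)) := by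
    rintro ⟨a, c⟩ ⟨a', c'⟩ h
    have hlt := hB' a' c' (h.mono inter_subset_right)
    rcases hAB a c a' c' h with ⟨rfl, rfl⟩ | ⟨rfl, rfl⟩ | ⟨rfl, rfl⟩
    exacts [h₀ _ _ hlt, h₁ _ _ hlt, h₂ _ _ hlt]
  have hdiff : ∀ v y : ℕ × ℕ, ∀ x ∈ U (.inl v) ∩ U (.inr y),
      pathDiff (σ (.inl v) x) (σ (.inr y) x) = u v.1 v.2 * k v y * (u y.1 y.2 * k y y)⁻¹ := by
    intro v y x hx
    have h : (U (.inl v) ∩ U (.inr y)).Nonempty := ⟨x, hx⟩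
    have h2 : pathDiff (σ₀ (.inl v) x) (σ₀ (.inr y) x) = k v y := by
      simp only [k, dif_pos h]
      exact (hσ₀ _).pathDiff_eq (hσ₀ _) ((hpcAB v y h).joinedIn x hx _ h.some_mem)
    rw [← h2]
    exact pathDiff_trans_trans _ _ _ _
  have e₁ : ∀ a c, ∀ x ∈ A a c ∩ B a c, pathDiff (σ (.inl (a, c)) x) (σ (.inr (a, c)) x) = 1 := by
    intro a c x hx
    rw [hdiff (a, c) (a, c) x hx]
    simp only [mul_inv_cancel]
  have e₀ : ∀ a c, ∀ x ∈ A (a + 1) c ∩ B a c,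
      pathDiff (σ (.inl (a + 1, c)) x) (σ (.inr (a, c)) x) = 1 := by
    intro a c x hx
    rw [hdiff (a + 1, c) (a, c) x hx]
    have : u (a + 1) c = u a c * k (a, c) (a, c) * (k (a + 1, c) (a, c))⁻¹ := by
      simp only [u, treeGauge]
    simp only [this, inv_mul_cancel_right, mul_inv_cancel]
  have e₂ : ∀ c, ∀ x ∈ A 0 (c + 1) ∩ B 0 c,
      pathDiff (σ (.inl (0, c + 1)) x) (σ (.inr (0, c)) x) = 1 := by
    intro c x hx
    rw [hdiff (0, c + 1) (0, c) x hx]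
    have : u 0 (c + 1) = u 0 c * k (0, c) (0, c) * (k (0, c + 1) (0, c))⁻¹ := by
      simp only [u, treeGauge]
    simp only [this, inv_mul_cancel_right, mul_inv_cancel]
  let φ : FreeGroup {p : ℕ × ℕ // 1 ≤ p.1 ∧ p.1 + p.2 < n} →* FundamentalGroup X x₀ :=
    FreeGroup.lift fun s => u s.1.1 (s.1.2 + 1) * k (s.1.1, s.1.2 + 1) s.1 *
      (u s.1.1 s.1.2 * k s.1 s.1)⁻¹
  have φ_of : ∀ s : {p : ℕ × ℕ // 1 ≤ p.1 ∧ p.1 + p.2 < n}, ∀ x ∈ A s.1.1 (s.1.2 + 1) ∩ B s.1.1 s.1.2,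
      φ (.of s) = pathDiff (σ (.inl (s.1.1, s.1.2 + 1)) x) (σ (.inr s.1) x) := by
    intro s x hx
    rw [hdiff (s.1.1, s.1.2 + 1) s.1 x hx, FreeGroup.lift_apply_of]
  have φ_surj : Function.Surjective φ := by
    have hmem : ∀ v y : ℕ × ℕ, ∀ x ∈ U (.inl v) ∩ U (.inr y),
        pathDiff (σ (.inl v) x) (σ (.inr y) x) ∈ φ.range := by
      rintro ⟨a, c⟩ ⟨a', c'⟩ x hx
      have hlt := hB' a' c' ⟨x, hx.2⟩
      rcases hAB a c a' c' ⟨x, hx⟩ with ⟨rfl, rfl⟩ | ⟨rfl, rfl⟩ | ⟨rfl, rfl⟩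
      · rw [e₀ _ _ x hx]; exact one_mem _
      · rw [e₁ _ _ x hx]; exact one_mem _
      · rcases Nat.eq_zero_or_pos a with rfl | ha
        · rw [e₂ _ x hx]; exact one_mem _
        · exact ⟨_, φ_of ⟨(a, c'), ha, hlt⟩ x hx⟩
    intro g
    refine mem_of_pathDiff_mem hUo hUcov hσ φ.range ?_ g
    rintro (v | v) (y | y) x hx
    · obtain ⟨h, h'⟩ := hAA _ _ _ _ ⟨x, hx⟩
      obtain rfl : v = y := Prod.ext h h'
      rw [pathDiff_self]; exact one_mem _
    · exact hmem v y x hx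
    · rw [← pathDiff_inv]
      exact inv_mem (hmem y v x hx.symm)
    · obtain ⟨h, h'⟩ := hBB _ _ _ _ ⟨x, hx⟩
      obtain rfl : v = y := Prod.ext h h'
      rw [pathDiff_self]; exact one_mem _
  have φ_inj : Function.Injective φ := by
    obtain ⟨T, M, m, hm, hM⟩ := exists_monodromy_of_cocycle hUo hUcov hσ
      (fun i h => (hUsc i h).isPathConnected) (triangularCocycle n)
      (by rintro (i | i) <;> rfl) (by
        rintro (i | i) (j | j) (l | l) ⟨x, ⟨hi, hj⟩, hl⟩
        all_goals
          try obtain rfl := Prod.ext_iff.2 (hAA _ _ _ _ ⟨x, hi, hj⟩)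
          try obtain rfl := Prod.ext_iff.2 (hAA _ _ _ _ ⟨x, hi, hl⟩)
          try obtain rfl := Prod.ext_iff.2 (hAA _ _ _ _ ⟨x, hj, hl⟩)
          try obtain rfl := Prod.ext_iff.2 (hBB _ _ _ _ ⟨x, hi, hj⟩)
          try obtain rfl := Prod.ext_iff.2 (hBB _ _ _ _ ⟨x, hi, hl⟩)
          try obtain rfl := Prod.ext_iff.2 (hBB _ _ _ _ ⟨x, hj, hl⟩)
          first | exact inv_mul_cancel _ | simp [triangularCocycle])
    have mB : ∀ a c, a + c < n → ∀ g, m (.inr (a, c)) g = m (.inl (a, c)) g := by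
      intro a c h g
      obtain ⟨x, hx⟩ := (h₁ a c h).nonempty
      have := hM (.inl (a, c)) (.inr (a, c)) x hx g
      rw [e₁ a c x hx, map_one, Equiv.Perm.one_apply] at this
      simpa [triangularCocycle] using this
    have mA : ∀ a c, a + c ≤ n → ∀ g, m (.inl (a, c)) g = m (.inl (0, 0)) g := by
      intro a
      induction a with
      | zero =>
        intro c
        induction c with
        | zero => exact fun _ _ => rfl
        | succ c ih =>
          intro h g
          rw [← ih (by omega) g, ← mB 0 c (by omega)]
          obtain ⟨x, hx⟩ := (h₂ 0 c (by omega)).nonempty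
          have := hM (.inl (0, c + 1)) (.inr (0, c)) x hx g
          rw [e₂ c x hx, map_one, Equiv.Perm.one_apply] at this
          simpa [triangularCocycle] using this.symm
      | succ a ih =>
        intro c h g
        rw [← ih c (by omega) g, ← mB a c (by omega)]
        obtain ⟨x, hx⟩ := (h₀ a c (by omega)).nonempty
        have := hM (.inl (a + 1, c)) (.inr (a, c)) x hx g
        rw [e₀ a c x hx, map_one, Equiv.Perm.one_apply] at this
        simpa [triangularCocycle] using this.symm
    have key : ∀ w g, M (φ w) (m (.inl (0, 0)) g) = m (.inl (0, 0)) (w * g) := by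
      intro w
      induction w using FreeGroup.induction_on with
      | C1 => exact fun g => by rw [map_one, map_one, Equiv.Perm.one_apply, one_mul]
      | of s =>
        intro g
        obtain ⟨⟨a, c⟩, ha, hac⟩ := s
        obtain ⟨x, hx⟩ := (h₂ a c hac).nonempty
        have := hM (.inl (a, c + 1)) (.inr (a, c)) x hx g
        rw [← φ_of ⟨(a, c), ha, hac⟩ x hx, mB a c hac, mA a c hac.le,
          mA a (c + 1) (by omega)] at this
        rw [this]
        simp [triangularCocycle, ha, hac]
      | inv_of s ih =>
        intro g
        rw [map_inv, map_inv, Equiv.Perm.inv_eq_iff_eq, ih, mul_inv_cancel_left]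
      | mul w w' ih ih' =>
        intro g
        rw [map_mul, map_mul, Equiv.Perm.mul_apply, ih', ih, mul_assoc]
    rw [injective_iff_map_eq_one]
    intro w hw
    have := key w 1
    rw [hw, map_one, Equiv.Perm.one_apply, mul_one] at this
    exact (hm (.inl (0, 0)) (hA 0 0 (by omega)).nonempty this).symm
  exact ⟨(MulEquiv.ofBijective φ ⟨φ_inj, φ_surj⟩).symm⟩

end TriangularCover

section StarCoordinates

/-- The direction of the `i`-th arm of the star. -/
def armDir (i : Fin 3) : ℂ :=
  exp (2 * π * I / 3) ^ (i : ℕ)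

theorem norm_armDir (i : Fin 3) : ‖armDir i‖ = 1 := by
  have h : (2 * π * I / 3 : ℂ) = ((2 * π / 3 : ℝ) : ℂ) * I := by push_cast; ring
  rw [armDir, norm_pow, h, norm_exp_ofReal_mul_I, one_pow]

theorem armDir_injective : Function.Injective armDir := fun i j h =>
  Fin.ext ((isPrimitiveRoot_exp 3 (by norm_num)).pow_inj i.2 j.2 (by simpa [armDir] using h))

theorem mem_threeStar_iff {z : ℂ} : z ∈ threeStar ↔ ‖z‖ ≤ 1 ∧ ∃ i, z = ‖z‖ * armDir i := by
  have key : ∀ j : ℕ, exp (2 * π * j / 3 * I) = exp (2 * π * I / 3) ^ j := by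
    intro j
    rw [← exp_nat_mul]
    congr 1
    ring
  simp only [threeStar, mem_iUnion, Finset.mem_range, mem_ofPred_eq, exists_prop, key]
  constructor
  · rintro ⟨j, hj, r, h0, h1, rfl⟩
    have : ‖(r : ℂ) * exp (2 * π * I / 3) ^ j‖ = r := by
      have := norm_armDir ⟨j, hj⟩
      rw [armDir] at this
      rw [norm_mul, this, mul_one, norm_real, Real.norm_of_nonneg h0]
    rw [this]
    exact ⟨h1, ⟨j, hj⟩, rfl⟩
  · rintro ⟨h, i, hi⟩
    exact ⟨i, i.2, ‖z‖, norm_nonneg z, h, hi⟩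

/-- The distance of a point of the star to the center. -/
def starNorm (z : threeStar) : ℝ :=
  ‖(z : ℂ)‖

/-- The arm containing a given point of the star. -/
def starArm (z : threeStar) : Fin 3 :=
  (mem_threeStar_iff.1 z.2).2.choose

/-- The point at distance `r` from the center on the `i`-th arm. -/
def starPoint (i : Fin 3) (r : ℝ) : threeStar :=
  ⟨(max 0 (min r 1) : ℝ) * armDir i, mem_threeStar_iff.2 (by
    have h : ‖((max 0 (min r 1) : ℝ) : ℂ) * armDir i‖ = max 0 (min r 1) := by
      rw [norm_mul, norm_armDir, mul_one, norm_real, Real.norm_of_nonneg (le_max_left _ _)]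
    rw [h]
    exact ⟨max_le zero_le_one (min_le_right _ _), i, rfl⟩)⟩

theorem coe_eq_starNorm_mul (z : threeStar) : (z : ℂ) = starNorm z * armDir (starArm z) :=
  (mem_threeStar_iff.1 z.2).2.choose_spec

theorem starNorm_nonneg (z : threeStar) : 0 ≤ starNorm z :=
  norm_nonneg _

theorem starNorm_le_one (z : threeStar) : starNorm z ≤ 1 :=
  (mem_threeStar_iff.1 z.2).1

theorem continuous_starNorm : Continuous starNorm :=
  continuous_norm.comp continuous_subtype_val

theorem coe_starPoint (i : Fin 3) {r : ℝ} (h0 : 0 ≤ r) (h1 : r ≤ 1) :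
    (starPoint i r : ℂ) = r * armDir i := by
  simp [starPoint, h0, h1]

theorem starNorm_starPoint (i : Fin 3) {r : ℝ} (h0 : 0 ≤ r) (h1 : r ≤ 1) :
    starNorm (starPoint i r) = r := by
  rw [starNorm, coe_starPoint i h0 h1, norm_mul, norm_armDir, mul_one, norm_real,
    Real.norm_of_nonneg h0]

theorem starPoint_starArm (z : threeStar) : starPoint (starArm z) (starNorm z) = z :=
  Subtype.ext <| by
    rw [coe_starPoint _ (starNorm_nonneg z) (starNorm_le_one z), ← coe_eq_starNorm_mul]

theorem starArm_starPoint (i : Fin 3) {r : ℝ} (h0 : 0 < r) (h1 : r ≤ 1) :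
    starArm (starPoint i r) = i := by
  have h := coe_eq_starNorm_mul (starPoint i r)
  rw [starNorm_starPoint i h0.le h1, coe_starPoint i h0.le h1] at h
  exact (armDir_injective (mul_left_cancel₀ (ofReal_ne_zero.2 h0.ne') h)).symm

theorem starPoint_zero (i j : Fin 3) : starPoint i 0 = starPoint j 0 :=
  Subtype.ext <| by simp [starPoint]

theorem continuous_starPoint (i : Fin 3) : Continuous (starPoint i) := by
  unfold starPoint
  fun_prop

theorem eq_of_starArm_eq {z w : threeStar} (h : starArm z = starArm w)
    (h' : starNorm z = starNorm w) : z = w := by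
  rw [← starPoint_starArm z, ← starPoint_starArm w, h, h']

theorem isOpen_starArm_eq (i : Fin 3) : IsOpen {z | starNorm z ≠ 0 ∧ starArm z = i} := by
  have : {z | starNorm z ≠ 0 ∧ starArm z = i}ᶜ =
      ⋃ j ∈ {j | j ≠ i}, {z : threeStar | (z : ℂ) = starNorm z * armDir j} := by
    ext z
    simp only [mem_compl_iff, mem_ofPred_eq, mem_iUnion, exists_prop]
    constructor
    · intro h
      by_cases h0 : starNorm z = 0
      · have hz : (z : ℂ) = 0 := norm_eq_zero.1 h0
        obtain ⟨j, hj⟩ := exists_ne i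
        exact ⟨j, hj, by simp [h0, hz]⟩
      · exact ⟨starArm z, fun h1 => h ⟨h0, h1⟩, coe_eq_starNorm_mul z⟩
    · rintro ⟨j, hj, hz⟩ ⟨h0, rfl⟩
      rw [coe_eq_starNorm_mul z] at hz
      exact hj (armDir_injective (mul_left_cancel₀ (ofReal_ne_zero.2 h0) hz)).symm
  rw [← isClosed_compl_iff, this]
  refine (toFinite _).isClosed_biUnion fun j _ => isClosed_eq continuous_subtype_val ?_
  exact (continuous_ofReal.comp continuous_starNorm).mul continuous_const

theorem coe_starPoint_mul (z : threeStar) {s : ℝ} (h0 : 0 ≤ s) (h1 : s ≤ 1) :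
    (starPoint (starArm z) (s * starNorm z) : ℂ) = s * z := by
  rw [coe_starPoint _ (mul_nonneg h0 (starNorm_nonneg z))
    (mul_le_one₀ h1 (starNorm_nonneg z) (starNorm_le_one z)), ofReal_mul, mul_assoc,
    ← coe_eq_starNorm_mul]

end StarCoordinates

section Configurations

theorem continuous_confProj (n : ℕ) (X : Type*) [TopologicalSpace X] :
    Continuous (confProj n X) :=
  continuous_coinduced_rng

theorem confProj_surjective (n : ℕ) (X : Type*) [TopologicalSpace X] :
    Function.Surjective (confProj n X) := by
  rintro ⟨s, hs, hn⟩
  have : Finite s := hs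
  have e : Fin n ≃ s := (Finite.equivFinOfCardEq hn).symm
  exact ⟨⟨fun i => e i, Subtype.val_injective.comp e.injective⟩, Subtype.ext <| by
    change range (Subtype.val ∘ e) = s
    rw [e.surjective.range_comp, Subtype.range_val]⟩

theorem isOpenMap_confProj (n : ℕ) (X : Type*) [TopologicalSpace X] :
    IsOpenMap (confProj n X) := by
  intro U hU
  have key : confProj n X ⁻¹' (confProj n X '' U) =
      ⋃ σ : Equiv.Perm (Fin n), (fun f : OrdConf n X =>
        (⟨f.1 ∘ σ, f.2.comp σ.injective⟩ : OrdConf n X)) ⁻¹' U := by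
    ext f
    simp only [mem_preimage, mem_image, mem_iUnion]
    constructor
    · rintro ⟨g, hg, hgf⟩
      have hr : range g.1 = range f.1 := congrArg Subtype.val hgf
      let σ : Equiv.Perm (Fin n) := (Equiv.ofInjective g.1 g.2).trans
        ((Equiv.setCongr hr).trans (Equiv.ofInjective f.1 f.2).symm)
      have h : (⟨f.1 ∘ σ, f.2.comp σ.injective⟩ : OrdConf n X) = g :=
        Subtype.ext (funext fun j => by simp [σ, Equiv.apply_ofInjective_symm])
      exact ⟨σ, show (⟨f.1 ∘ σ, f.2.comp σ.injective⟩ : OrdConf n X) ∈ U from h ▸ hg⟩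
    · rintro ⟨σ, h⟩
      exact ⟨_, h, Subtype.ext (σ.surjective.range_comp f.1)⟩
  refine isOpen_coinduced.2 ?_
  rw [key]
  refine isOpen_iUnion fun σ => hU.preimage ?_
  refine Continuous.subtype_mk ?_ _
  exact continuous_pi fun j => (continuous_apply (σ j)).comp continuous_subtype_val

end Configurations

section Regions

/-- A point of a configuration `s` is tame with respect to the flag `b` if `b` holds or if it is not
among the points of `s` closest to the center. -/
def IsTame (b : Prop) (s : Set threeStar) (z : threeStar) : Prop :=
  b ∨ ∃ w ∈ s, starNorm w < starNorm z

theorem IsTame.mono {b : Prop} {s : Set threeStar} {z w : threeStar} (h : IsTame b s z)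
    (hzw : starNorm z ≤ starNorm w) : IsTame b s w :=
  h.imp id fun ⟨u, hu, huz⟩ => ⟨u, hu, huz.trans_le hzw⟩

theorem IsTame.lt_of_not {b : Prop} {s : Set threeStar} {z w : threeStar} (hw : IsTame b s w)
    (hz : ¬IsTame b s z) : starNorm z < starNorm w := by
  by_contra! h
  exact hz (hw.mono h)

theorem IsTame.starNorm_pos {b : Prop} {s : Set threeStar} {z : threeStar}
    (hs : b → ∀ z ∈ s, starNorm z ≠ 0) (h : IsTame b s z) (hz : z ∈ s) : 0 < starNorm z := by
  rcases h with h | ⟨w, -, h⟩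
  · exact (starNorm_nonneg z).lt_of_ne' (hs h z hz)
  · exact (starNorm_nonneg w).trans_lt h

/-- The number of tame points of a configuration on each arm. -/
def tameCount (b : Prop) (s : Set threeStar) (i : Fin 3) : ℕ :=
  {z ∈ s | IsTame b s z ∧ starArm z = i}.ncard

/-- The configurations all of whose points are tame except perhaps one, with tame points away from
the center and distributed on the arms as prescribed by `α`. -/
def region (n : ℕ) (b : Prop) (α : Fin 3 → ℕ) : Set (UConf n threeStar) :=
  {s | (b → ∀ z ∈ s.1, starNorm z ≠ 0) ∧
    (∀ z ∈ s.1, ∀ w ∈ s.1, ¬IsTame b s.1 z → ¬IsTame b s.1 w → z = w) ∧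
    ∀ i, tameCount b s.1 i = α i}

/-- The distance to the center of a point after spreading the tame points on their arms. -/
def spreadNorm (n : ℕ) (b : Prop) (ε : ℝ) (s : Set threeStar) (z : threeStar) : ℝ :=
  open Classical in
  if IsTame b s z then
    (({w ∈ s | IsTame b s w ∧ starArm w = starArm z ∧ starNorm w < starNorm z}.ncard : ℝ) + 1) /
      (n + 1)
  else ε

/-- The linear motion of a point towards its spread position. -/
def spread (n : ℕ) (b : Prop) (ε : ℝ) (s : Set threeStar) (t : ℝ) (z : threeStar) : threeStar :=
  starPoint (starArm z) ((1 - t) * starNorm z + t * spreadNorm n b ε s z)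

variable {n : ℕ} {b : Prop} {α β : Fin 3 → ℕ} {ε t : ℝ} {s : Set threeStar} {z w : threeStar}

theorem spread_zero : spread n b ε s 0 z = z := by
  simp [spread, starPoint_starArm]

theorem spreadNorm_of_isTame (h : IsTame b s z) : spreadNorm n b ε s z =
    (({w ∈ s | IsTame b s w ∧ starArm w = starArm z ∧ starNorm w < starNorm z}.ncard : ℝ) + 1) /
      (n + 1) :=
  if_pos h

theorem spreadNorm_of_not_isTame (h : ¬IsTame b s z) : spreadNorm n b ε s z = ε :=
  if_neg h

theorem ncard_lt_tameCount (hs : s.Finite) (hz : z ∈ s) (h : IsTame b s z) :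
    {w ∈ s | IsTame b s w ∧ starArm w = starArm z ∧ starNorm w < starNorm z}.ncard <
      tameCount b s (starArm z) := by
  refine ncard_lt_ncard ⟨fun w hw => ⟨hw.1, hw.2.1, hw.2.2.1⟩, fun hle => ?_⟩
    (hs.subset fun w hw => hw.1)
  exact lt_irrefl _ (hle ⟨hz, h, rfl⟩).2.2.2

theorem tameCount_le (hs : s.Finite) (i : Fin 3) : tameCount b s i ≤ s.ncard :=
  ncard_le_ncard (fun _ hw => hw.1) hs

theorem spreadNorm_nonneg (hε : 0 ≤ ε) : 0 ≤ spreadNorm n b ε s z := by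
  unfold spreadNorm
  split_ifs
  · positivity
  · exact hε

theorem spreadNorm_le_one (hs : s.Finite) (hn : s.ncard = n) (hz : z ∈ s)
    (hε' : ε < 1 / (n + 1)) : spreadNorm n b ε s z ≤ 1 := by
  have hn0 : (0 : ℝ) < n + 1 := by positivity
  by_cases h : IsTame b s z
  · rw [spreadNorm_of_isTame h, div_le_one hn0]
    have := (ncard_lt_tameCount hs hz h).le.trans (tameCount_le hs _)
    rw [hn] at this
    gcongr
  · rw [spreadNorm_of_not_isTame h]
    refine hε'.le.trans ?_
    rw [div_le_one hn0]
    linarith [(Nat.cast_nonneg n : (0 : ℝ) ≤ n)]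

theorem le_spreadNorm (h : IsTame b s z) : 1 / (n + 1) ≤ spreadNorm n b ε s z := by
  rw [spreadNorm_of_isTame h]
  gcongr
  simp

theorem spreadNorm_lt (hs : s.Finite) (hz : z ∈ s) (h : IsTame b s z)
    (harm : starArm z = starArm w) (hlt : starNorm z < starNorm w) :
    spreadNorm n b ε s z < spreadNorm n b ε s w := by
  rw [spreadNorm_of_isTame h, spreadNorm_of_isTame (h.mono hlt.le)]
  gcongr
  refine ncard_lt_ncard ⟨fun u hu => ⟨hu.1, hu.2.1, hu.2.2.1.trans harm, hu.2.2.2.trans hlt⟩,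
    fun hle => ?_⟩ (hs.subset fun u hu => hu.1)
  exact lt_irrefl _ (hle ⟨hz, h, harm, hlt⟩).2.2.2

/-- The distance to the center during the motion. -/
def spreadRadius (n : ℕ) (b : Prop) (ε : ℝ) (s : Set threeStar) (t : ℝ) (z : threeStar) : ℝ :=
  (1 - t) * starNorm z + t * spreadNorm n b ε s z

theorem convex_lt {x y x' y' t : ℝ} (h : x < y) (h' : x' < y') (ht0 : 0 ≤ t) (ht1 : t ≤ 1) :
    (1 - t) * x + t * x' < (1 - t) * y + t * y' := by
  rcases ht0.eq_or_lt with rfl | ht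
  · simpa using h
  · have := mul_le_mul_of_nonneg_left h.le (sub_nonneg.2 ht1)
    have := mul_lt_mul_of_pos_left h' ht
    linarith

theorem spreadRadius_nonneg (hε : 0 ≤ ε) (ht0 : 0 ≤ t) (ht1 : t ≤ 1) :
    0 ≤ spreadRadius n b ε s t z :=
  add_nonneg (mul_nonneg (sub_nonneg.2 ht1) (starNorm_nonneg z))
    (mul_nonneg ht0 (spreadNorm_nonneg hε))

theorem spreadRadius_le_one (hs : s.Finite) (hn : s.ncard = n) (hz : z ∈ s)
    (hε' : ε < 1 / (n + 1)) (ht0 : 0 ≤ t) (ht1 : t ≤ 1) : spreadRadius n b ε s t z ≤ 1 := by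
  have h1 := mul_le_of_le_one_right (sub_nonneg.2 ht1) (starNorm_le_one z)
  have h2 := mul_le_of_le_one_right ht0 (spreadNorm_le_one (b := b) hs hn hz hε')
  unfold spreadRadius
  linarith

theorem spreadRadius_pos (h : IsTame b s z) (h0 : 0 < starNorm z) (ht0 : 0 ≤ t) (ht1 : t ≤ 1) :
    0 < spreadRadius n b ε s t z := by
  have h1 : (0 : ℝ) < spreadNorm n b ε s z :=
    lt_of_lt_of_le (by positivity) (le_spreadNorm h)
  simpa [spreadRadius] using convex_lt h0 h1 ht0 ht1

theorem spreadRadius_lt_of_not (hw : IsTame b s w) (hz : ¬IsTame b s z) (hε' : ε < 1 / (n + 1))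
    (ht0 : 0 ≤ t) (ht1 : t ≤ 1) : spreadRadius n b ε s t z < spreadRadius n b ε s t w := by
  refine convex_lt (hw.lt_of_not hz) ?_ ht0 ht1
  rw [spreadNorm_of_not_isTame hz]
  exact hε'.trans_le (le_spreadNorm hw)

theorem starNorm_spread (hs : s.Finite) (hn : s.ncard = n) (hz : z ∈ s) (hε : 0 ≤ ε)
    (hε' : ε < 1 / (n + 1)) (ht0 : 0 ≤ t) (ht1 : t ≤ 1) :
    starNorm (spread n b ε s t z) = spreadRadius n b ε s t z :=
  starNorm_starPoint _ (spreadRadius_nonneg hε ht0 ht1)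
    (spreadRadius_le_one hs hn hz hε' ht0 ht1)

theorem starArm_spread (hs : s.Finite) (hn : s.ncard = n) (hz : z ∈ s)
    (hε' : ε < 1 / (n + 1)) (ht0 : 0 ≤ t) (ht1 : t ≤ 1) (h : 0 < spreadRadius n b ε s t z) :
    starArm (spread n b ε s t z) = starArm z :=
  starArm_starPoint _ h (spreadRadius_le_one hs hn hz hε' ht0 ht1)

theorem isTame_spread_iff (hs : s.Finite) (hn : s.ncard = n) (hz : z ∈ s) (hε : 0 ≤ ε)
    (hε' : ε < 1 / (n + 1)) (ht0 : 0 ≤ t) (ht1 : t ≤ 1)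
    (hu : ∀ z ∈ s, ∀ w ∈ s, ¬IsTame b s z → ¬IsTame b s w → z = w) :
    IsTame b (spread n b ε s t '' s) (spread n b ε s t z) ↔ IsTame b s z := by
  constructor
  · rintro (hb | ⟨_, ⟨w, hw, rfl⟩, h⟩)
    · exact .inl hb
    · rw [starNorm_spread hs hn hw hε hε' ht0 ht1, starNorm_spread hs hn hz hε hε' ht0 ht1] at h
      by_contra hz'
      by_cases hw' : IsTame b s w
      · exact lt_asymm h (spreadRadius_lt_of_not hw' hz' hε' ht0 ht1)
      · rw [hu z hz w hw hz' hw'] at h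
        exact lt_irrefl _ h
  · intro h
    by_cases hb : b
    · exact .inl hb
    · obtain ⟨w, hw, hmin⟩ := s.exists_min_image starNorm hs ⟨z, hz⟩
      have hw' : ¬IsTame b s w := not_or.2 ⟨hb, by simpa using hmin⟩
      refine .inr ⟨_, mem_image_of_mem _ hw, ?_⟩
      rw [starNorm_spread hs hn hw hε hε' ht0 ht1, starNorm_spread hs hn hz hε hε' ht0 ht1]
      exact spreadRadius_lt_of_not h hw' hε' ht0 ht1

theorem injOn_spread (hs : s.Finite) (hn : s.ncard = n) (hε : 0 ≤ ε)
    (hε' : ε < 1 / (n + 1)) (ht0 : 0 ≤ t) (ht1 : t ≤ 1) (hb : b → ∀ z ∈ s, starNorm z ≠ 0)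
    (hu : ∀ z ∈ s, ∀ w ∈ s, ¬IsTame b s z → ¬IsTame b s w → z = w) :
    InjOn (spread n b ε s t) s := by
  intro z hz w hw h
  have hnorm := congrArg starNorm h
  rw [starNorm_spread hs hn hz hε hε' ht0 ht1, starNorm_spread hs hn hw hε hε' ht0 ht1] at hnorm
  by_cases hz' : IsTame b s z <;> by_cases hw' : IsTame b s w
  · have harm := congrArg starArm h
    rw [starArm_spread hs hn hz hε' ht0 ht1
      (spreadRadius_pos hz' (hz'.starNorm_pos hb hz) ht0 ht1),
      starArm_spread hs hn hw hε' ht0 ht1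
      (spreadRadius_pos hw' (hw'.starNorm_pos hb hw) ht0 ht1)] at harm
    rcases lt_trichotomy (starNorm z) (starNorm w) with hlt | heq | hlt
    · exact absurd hnorm (convex_lt hlt (spreadNorm_lt hs hz hz' harm hlt) ht0 ht1).ne
    · exact eq_of_starArm_eq harm heq
    · exact absurd hnorm (convex_lt hlt (spreadNorm_lt hs hw hw' harm.symm hlt) ht0 ht1).ne'
  · exact absurd hnorm (spreadRadius_lt_of_not hz' hw' hε' ht0 ht1).ne'
  · exact absurd hnorm (spreadRadius_lt_of_not hw' hz' hε' ht0 ht1).ne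
  · exact hu z hz w hw hz' hw'

theorem tameCount_image_spread {b' : Prop} (hs : s.Finite) (hn : s.ncard = n)
    (hε' : ε < 1 / (n + 1)) (ht0 : 0 ≤ t) (ht1 : t ≤ 1) (hinj : InjOn (spread n b ε s t) s)
    (htame : ∀ z ∈ s, IsTame b' (spread n b ε s t '' s) (spread n b ε s t z) ↔ IsTame b' s z)
    (hpos : ∀ z ∈ s, IsTame b' s z → 0 < spreadRadius n b ε s t z) (i : Fin 3) :
    tameCount b' (spread n b ε s t '' s) i = tameCount b' s i := by
  have : {z ∈ spread n b ε s t '' s | IsTame b' (spread n b ε s t '' s) z ∧ starArm z = i} =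
      spread n b ε s t '' {z ∈ s | IsTame b' s z ∧ starArm z = i} := by
    ext x
    constructor
    · rintro ⟨⟨z, hz, rfl⟩, h, ha⟩
      have hz' := (htame z hz).1 h
      rw [starArm_spread hs hn hz hε' ht0 ht1 (hpos z hz hz')] at ha
      exact ⟨z, ⟨hz, hz', ha⟩, rfl⟩
    · rintro ⟨z, ⟨hz, hz', ha⟩, rfl⟩
      refine ⟨mem_image_of_mem _ hz, (htame z hz).2 hz', ?_⟩
      rwa [starArm_spread hs hn hz hε' ht0 ht1 (hpos z hz hz')]
  rw [tameCount, this, (hinj.mono fun _ hz => hz.1).ncard_image, tameCount]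

theorem sum_tameCount (hs : s.Finite) : ∑ i, tameCount b s i = {z ∈ s | IsTame b s z}.ncard := by
  classical
  lift s to Finset threeStar using hs
  have h1 : {z ∈ (s : Set threeStar) | IsTame b s z} = ↑({z ∈ s | IsTame b s z} : Finset _) := by
    ext; simp
  have h2 : ∀ i, {z ∈ (s : Set threeStar) | IsTame b s z ∧ starArm z = i} =
      ↑({z ∈ ({z ∈ s | IsTame b s z} : Finset _) | starArm z = i} : Finset _) := by
    intro i; ext; simp [and_assoc]
  simp only [tameCount, h2]
  rw [h1]
  simp only [ncard_coe_finset]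
  exact (Finset.card_eq_sum_card_fiberwise fun _ _ => Finset.mem_coe.2 (Finset.mem_univ _)).symm

/-- The configuration with `β i` equidistant points on the `i`-th arm. -/
def standardSet (n : ℕ) (β : Fin 3 → ℕ) : Set threeStar :=
  range fun p : Σ i, Fin (β i) => starPoint p.1 (((p.2 : ℕ) + 1 : ℝ) / (n + 1))

theorem ncard_standardSet_le (n : ℕ) (β : Fin 3 → ℕ) : (standardSet n β).ncard ≤ ∑ i, β i := by
  classical
  have h : standardSet n β = ↑(Finset.univ.image fun p : Σ i, Fin (β i) =>
      starPoint p.1 (((p.2 : ℕ) + 1 : ℝ) / (n + 1))) := by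
    simp [standardSet]
  rw [h, ncard_coe_finset]
  exact Finset.card_image_le.trans (by simp)

theorem image_spread_one (hs : s.Finite) (hβ : ∀ i, tameCount b s i = β i)
    (hinj : InjOn (spread n b ε s 1) s) :
    spread n b ε s 1 '' s = standardSet n β ∪ spread n b ε s 1 '' {z ∈ s | ¬IsTame b s z} := by
  have hsub : spread n b ε s 1 '' {z ∈ s | IsTame b s z} ⊆ standardSet n β := by
    rintro _ ⟨z, ⟨hz, h⟩, rfl⟩
    have hlt := ncard_lt_tameCount hs hz h
    rw [hβ] at hlt
    refine ⟨⟨starArm z, _, hlt⟩, ?_⟩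
    simp [spread, spreadNorm_of_isTame h]
  have heq : spread n b ε s 1 '' {z ∈ s | IsTame b s z} = standardSet n β := by
    refine eq_of_subset_of_ncard_le hsub ?_ (finite_range _)
    rw [(hinj.mono fun _ hz => hz.1).ncard_image, ← sum_tameCount hs]
    simp only [hβ]
    exact ncard_standardSet_le n β
  rw [← heq, ← image_union]
  congr 1
  ext z
  simp only [mem_union, mem_ofPred_eq]
  tauto

/-- The motion of a configuration towards its spread position. -/
def spreadConf (n : ℕ) (b : Prop) (ε : ℝ) (s : UConf n threeStar) (t : ℝ) : UConf n threeStar :=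
  open Classical in
  if h : InjOn (spread n b ε s.1 t) s.1 then
    ⟨spread n b ε s.1 t '' s.1, s.2.1.image _, by rw [h.ncard_image, s.2.2]⟩
  else s

theorem coe_spreadConf {s : UConf n threeStar} (h : InjOn (spread n b ε s.1 t) s.1) :
    (spreadConf n b ε s t).1 = spread n b ε s.1 t '' s.1 :=
  congrArg Subtype.val (dif_pos h)

theorem injOn_spread_of_mem {s : UConf n threeStar} (h : s ∈ region n b α) (hε : 0 ≤ ε)
    (hε' : ε < 1 / (n + 1)) (ht0 : 0 ≤ t) (ht1 : t ≤ 1) : InjOn (spread n b ε s.1 t) s.1 :=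
  injOn_spread s.2.1 s.2.2 hε hε' ht0 ht1 h.1 h.2.1

theorem spreadConf_mem {s : UConf n threeStar} (h : s ∈ region n b α) (hε : 0 ≤ ε)
    (hε' : ε < 1 / (n + 1)) (ht0 : 0 ≤ t) (ht1 : t ≤ 1) : spreadConf n b ε s t ∈ region n b α := by
  have hinj := injOn_spread_of_mem h hε hε' ht0 ht1
  have hT := fun z hz => isTame_spread_iff s.2.1 s.2.2 (z := z) hz hε hε' ht0 ht1 h.2.1
  have hpos : ∀ z ∈ s.1, IsTame b s.1 z → 0 < spreadRadius n b ε s.1 t z :=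
    fun z hz hz' => spreadRadius_pos hz' (hz'.starNorm_pos h.1 hz) ht0 ht1
  unfold region
  rw [mem_ofPred_eq, coe_spreadConf hinj]
  refine ⟨?_, ?_, fun i => ?_⟩
  · rintro hb _ ⟨z, hz, rfl⟩
    rw [starNorm_spread s.2.1 s.2.2 hz hε hε' ht0 ht1]
    exact (hpos z hz (.inl hb)).ne'
  · rintro _ ⟨z, hz, rfl⟩ _ ⟨w, hw, rfl⟩ hz' hw'
    rw [hT z hz] at hz'
    rw [hT w hw] at hw'
    rw [h.2.1 z hz w hw hz' hw']
  · rw [tameCount_image_spread s.2.1 s.2.2 hε' ht0 ht1 hinj hT hpos, h.2.2]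

theorem isTame_true : IsTame True s z :=
  .inl trivial

theorem sum_of_mem_region_true {s : UConf n threeStar} (h : s ∈ region n True α) :
    ∑ i, α i = n := by
  simp only [← h.2.2, sum_tameCount s.2.1, isTame_true, and_true]
  exact s.2.2

theorem exists_not_isTame_false {s : UConf n threeStar} (hn : 1 ≤ n)
    (h : s ∈ region n False β) : ∃ z ∈ s.1, {w ∈ s.1 | ¬IsTame False s.1 w} = {z} := by
  have hne : s.1.Nonempty := nonempty_of_ncard_ne_zero (by rw [s.2.2]; omega)
  obtain ⟨z, hz, hmin⟩ := s.1.exists_min_image starNorm s.2.1 hne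
  have hz' : ¬IsTame False s.1 z := not_or.2 ⟨id, by simpa using hmin⟩
  refine ⟨z, hz, eq_singleton_iff_unique_mem.2 ⟨⟨hz, hz'⟩, fun w hw => ?_⟩⟩
  exact h.2.1 w hw.1 z hz hw.2 hz'

theorem sum_of_mem_region_false {s : UConf n threeStar} (hn : 1 ≤ n)
    (h : s ∈ region n False β) : ∑ i, β i + 1 = n := by
  obtain ⟨z, hz, hzs⟩ := exists_not_isTame_false hn h
  have hu : s.1 = insert z {w ∈ s.1 | IsTame False s.1 w} := by
    ext w
    have := Set.ext_iff.1 hzs w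
    simp only [mem_ofPred_eq, mem_singleton_iff, mem_insert_iff] at this ⊢
    rw [← this]
    by_cases h : IsTame False s.1 w <;> simp [h]
  have hz' : z ∉ {w ∈ s.1 | IsTame False s.1 w} := fun hz' =>
    ((Set.ext_iff.1 hzs z).2 rfl).2 hz'.2
  simp only [← h.2.2, sum_tameCount s.2.1]
  rw [← ncard_insert_of_notMem hz' (s.2.1.subset fun _ hw => hw.1), ← hu, s.2.2]

theorem exists_eq_add_single {s : UConf n threeStar} (hn : 1 ≤ n)
    (h : s ∈ region n True α) (h' : s ∈ region n False β) :
    ∃ z ∈ s.1, {w ∈ s.1 | ¬IsTame False s.1 w} = {z} ∧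
      α = β + Pi.single (starArm z) 1 := by
  obtain ⟨z, hz, hzs⟩ := exists_not_isTame_false hn h'
  have hz' : ¬IsTame False s.1 z := ((Set.ext_iff.1 hzs z).2 rfl).2
  refine ⟨z, hz, hzs, funext fun i => ?_⟩
  rw [Pi.add_apply, ← h.2.2, ← h'.2.2]
  have hw : ∀ w ∈ s.1, ¬IsTame False s.1 w ↔ w = z := fun w hw => by
    simpa [hw] using Set.ext_iff.1 hzs w
  by_cases hi : i = starArm z
  · subst hi
    have : {w ∈ s.1 | IsTame True s.1 w ∧ starArm w = starArm z} =
        insert z {w ∈ s.1 | IsTame False s.1 w ∧ starArm w = starArm z} := by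
      ext w
      simp only [isTame_true, true_and, mem_ofPred_eq, mem_insert_iff]
      constructor
      · rintro ⟨h1, h2⟩
        by_cases h3 : IsTame False s.1 w
        exacts [.inr ⟨h1, h3, h2⟩, .inl ((hw w h1).1 h3)]
      · rintro (rfl | h1)
        exacts [⟨hz, rfl⟩, ⟨h1.1, h1.2.2⟩]
    rw [tameCount, this, ncard_insert_of_notMem (fun h => hz' h.2.1)
      (s.2.1.subset fun _ hw => hw.1), tameCount, Pi.single_eq_same]
  · rw [Pi.single_eq_of_ne hi, add_zero]
    refine congrArg ncard (Set.ext fun w => ?_)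
    simp only [isTame_true, true_and, mem_ofPred_eq]
    refine and_congr_right fun h1 => ⟨fun h2 => ⟨?_, h2⟩, fun h2 => h2.2⟩
    by_contra h3
    rw [hw w h1] at h3
    exact hi (by rw [← h2, h3])

theorem spreadConf_one_eq (hn : 1 ≤ n) {s s' : UConf n threeStar} (h : s ∈ region n b α)
    (h' : s' ∈ region n b α) : spreadConf n b 0 s 1 = spreadConf n b 0 s' 1 := by
  have hε' : (0 : ℝ) < 1 / (n + 1) := by positivity
  refine Subtype.ext ?_
  have hi := injOn_spread_of_mem h le_rfl hε' zero_le_one le_rfl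
  have hi' := injOn_spread_of_mem h' le_rfl hε' zero_le_one le_rfl
  rw [coe_spreadConf hi, coe_spreadConf hi', image_spread_one s.2.1 h.2.2 hi,
    image_spread_one s'.2.1 h'.2.2 hi']
  congr 1
  by_cases hb : b
  · have : ∀ (u : Set threeStar) z, IsTame b u z := fun _ _ => .inl hb
    simp [this]
  · obtain rfl : b = False := eq_false hb
    have key : ∀ s ∈ region n False α, spread n False 0 s.1 1 '' {z ∈ s.1 | ¬IsTame False s.1 z} =
        {starPoint 0 0} := by
      intro s hs
      obtain ⟨z, hz, hzs⟩ := exists_not_isTame_false hn hs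
      rw [hzs, image_singleton, spread,
        spreadNorm_of_not_isTame ((Set.ext_iff.1 hzs z).2 rfl).2]
      simp [starPoint_zero (starArm z) 0]
    rw [key s h, key s' h']

theorem continuous_spread (z : threeStar) : Continuous fun t => spread n b ε s t z :=
  (continuous_starPoint _).comp (by fun_prop)

theorem ncard_sep_range {ι X : Type*} {f : ι → X} (hf : Function.Injective f) (p : X → Prop) :
    {x ∈ range f | p x}.ncard = {i | p (f i)}.ncard := by
  rw [← ncard_image_of_injective _ hf]
  congr 1
  ext x
  constructor
  · rintro ⟨⟨i, rfl⟩, h⟩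
    exact ⟨i, h, rfl⟩
  · rintro ⟨i, h, rfl⟩
    exact ⟨⟨i, rfl⟩, h⟩

open Topology Filter

/-- Two labelled configurations have the same tame points, on the same arms and in the same
order. -/
structure SameType (b : Prop) (f f₀ : Fin n → threeStar) : Prop where
  isTame_iff : ∀ j, IsTame b (range f) (f j) ↔ IsTame b (range f₀) (f₀ j)
  starNorm_ne : ∀ j, IsTame b (range f₀) (f₀ j) → starNorm (f j) ≠ 0
  starArm_eq : ∀ j, IsTame b (range f₀) (f₀ j) → starArm (f j) = starArm (f₀ j)
  lt_iff : ∀ j, IsTame b (range f₀) (f₀ j) → ∀ k, IsTame b (range f₀) (f₀ k) →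
    starArm (f₀ k) = starArm (f₀ j) →
    (starNorm (f k) < starNorm (f j) ↔ starNorm (f₀ k) < starNorm (f₀ j))

theorem SameType.tameCount_eq {f f₀ : Fin n → threeStar} (hf : Function.Injective f)
    (hf₀ : Function.Injective f₀) (h : SameType b f f₀) (i : Fin 3) :
    tameCount b (range f) i = tameCount b (range f₀) i := by
  rw [tameCount, tameCount, ncard_sep_range hf, ncard_sep_range hf₀]
  congr 1
  ext j
  simp only [mem_ofPred_eq, h.isTame_iff]
  exact and_congr_right fun hj => by rw [h.starArm_eq j hj]

theorem SameType.spreadNorm_eq {f f₀ : Fin n → threeStar} (hf : Function.Injective f)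
    (hf₀ : Function.Injective f₀) (h : SameType b f f₀) {j : Fin n}
    (hj : IsTame b (range f₀) (f₀ j)) :
    spreadNorm n b ε (range f) (f j) = spreadNorm n b ε (range f₀) (f₀ j) := by
  rw [spreadNorm_of_isTame hj, spreadNorm_of_isTame ((h.isTame_iff j).2 hj),
    ncard_sep_range hf, ncard_sep_range hf₀]
  congr 4
  ext k
  simp only [mem_ofPred_eq, h.isTame_iff]
  refine and_congr_right fun hk => ?_
  rw [h.starArm_eq j hj, h.starArm_eq k hk]
  exact and_congr_right fun ha => h.lt_iff j hj k hk ha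

theorem continuous_starNorm_apply (j : Fin n) :
    Continuous fun f : OrdConf n threeStar => starNorm (f.1 j) :=
  continuous_starNorm.comp ((continuous_apply j).comp continuous_subtype_val)

theorem eventually_sameType {f₀ : OrdConf n threeStar}
    (h : confProj n threeStar f₀ ∈ region n b α) :
    ∀ᶠ f : OrdConf n threeStar in 𝓝 f₀, SameType b f.1 f₀.1 := by
  have lt_of_lt : ∀ j k, starNorm (f₀.1 j) < starNorm (f₀.1 k) →
      ∀ᶠ f : OrdConf n threeStar in 𝓝 f₀, starNorm (f.1 j) < starNorm (f.1 k) := fun j k hjk =>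
    (continuous_starNorm_apply j).continuousAt.eventually_lt
      (continuous_starNorm_apply k).continuousAt hjk
  have h1 : ∀ j, ∀ᶠ f : OrdConf n threeStar in 𝓝 f₀,
      (IsTame b (range f.1) (f.1 j) ↔ IsTame b (range f₀.1) (f₀.1 j)) := by
    intro j
    by_cases hj : IsTame b (range f₀.1) (f₀.1 j)
    · simp only [hj, iff_true]
      rcases hj with hb | ⟨_, ⟨k, rfl⟩, hk⟩
      · exact Eventually.of_forall fun f => .inl hb
      · exact (lt_of_lt k j hk).mono fun f hf => .inr ⟨_, mem_range_self k, hf⟩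
    · simp only [hj, iff_false]
      have : ∀ k, ∀ᶠ f : OrdConf n threeStar in 𝓝 f₀, k ≠ j → starNorm (f.1 j) < starNorm (f.1 k) := by
        intro k
        by_cases hkj : k = j
        · simp [hkj]
        · have hk : IsTame b (range f₀.1) (f₀.1 k) := by
            by_contra hk
            exact hkj (f₀.2 (h.2.1 _ (mem_range_self k) _ (mem_range_self j) hk hj))
          exact (lt_of_lt j k (hk.lt_of_not hj)).mono fun f hf _ => hf
      filter_upwards [eventually_all.2 this] with f hf
      refine not_or.2 ⟨fun hb => hj (.inl hb), ?_⟩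
      rintro ⟨_, ⟨k, rfl⟩, hk⟩
      by_cases hkj : k = j
      · exact lt_irrefl _ (hkj ▸ hk)
      · exact lt_asymm hk (hf k hkj)
  have h2 : ∀ j, ∀ᶠ f : OrdConf n threeStar in 𝓝 f₀, IsTame b (range f₀.1) (f₀.1 j) →
      starNorm (f.1 j) ≠ 0 ∧ starArm (f.1 j) = starArm (f₀.1 j) := by
    intro j
    by_cases hj : IsTame b (range f₀.1) (f₀.1 j)
    · have hc : ContinuousAt (fun f : OrdConf n threeStar => f.1 j) f₀ :=
        ((continuous_apply j).comp continuous_subtype_val).continuousAt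
      have hm := hc.eventually ((isOpen_starArm_eq (starArm (f₀.1 j))).mem_nhds
        ⟨(hj.starNorm_pos h.1 (mem_range_self j)).ne', rfl⟩)
      exact hm.mono fun f hf _ => hf
    · exact Eventually.of_forall fun f hf => absurd hf hj
  have h3 : ∀ j k, ∀ᶠ f : OrdConf n threeStar in 𝓝 f₀, starArm (f₀.1 k) = starArm (f₀.1 j) →
      (starNorm (f.1 k) < starNorm (f.1 j) ↔ starNorm (f₀.1 k) < starNorm (f₀.1 j)) := by
    intro j k
    rcases lt_trichotomy (starNorm (f₀.1 k)) (starNorm (f₀.1 j)) with hlt | heq | hlt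
    · exact (lt_of_lt k j hlt).mono fun f hf _ => iff_of_true hf hlt
    · refine Eventually.of_forall fun f ha => ?_
      obtain rfl := f₀.2 (eq_of_starArm_eq ha heq)
      simp
    · exact (lt_of_lt j k hlt).mono fun f hf _ => iff_of_false hf.not_gt hlt.not_gt
  filter_upwards [eventually_all.2 h1, eventually_all.2 h2,
    eventually_all.2 fun j => eventually_all.2 (h3 j)] with f g1 g2 g3
  exact ⟨g1, fun j hj => (g2 j hj).1, fun j hj => (g2 j hj).2, fun j _ k _ ha => g3 j k ha⟩

theorem isOpen_region (n : ℕ) (b : Prop) (α : Fin 3 → ℕ) : IsOpen (region n b α) := by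
  refine isOpen_coinduced.2 (isOpen_iff_mem_nhds.2 fun f₀ h => ?_)
  filter_upwards [eventually_sameType h] with f hf
  refine ⟨?_, ?_, fun i => (hf.tameCount_eq f.2 f₀.2 i).trans (h.2.2 i)⟩
  · rintro hb _ ⟨j, rfl⟩
    exact hf.starNorm_ne j (.inl hb)
  · rintro _ ⟨j, rfl⟩ _ ⟨k, rfl⟩ hj hk
    refine congrArg f.1 (f₀.2 (h.2.1 _ (mem_range_self j) _ (mem_range_self k) ?_ ?_))
    exacts [mt (hf.isTame_iff j).2 hj, mt (hf.isTame_iff k).2 hk]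

theorem continuousAt_spread {f₀ : OrdConf n threeStar}
    (h : confProj n threeStar f₀ ∈ region n b α) (t₀ : unitInterval) (j : Fin n) :
    ContinuousAt (fun p : unitInterval × OrdConf n threeStar =>
      spread n b 0 (range p.2.1) p.1 (p.2.1 j)) (t₀, f₀) := by
  have hev : ∀ᶠ p : unitInterval × OrdConf n threeStar in 𝓝 (t₀, f₀), SameType b p.2.1 f₀.1 :=
    continuousAt_snd.eventually (eventually_sameType h)
  have ht : Continuous fun p : unitInterval × OrdConf n threeStar => (p.1 : ℝ) :=
    continuous_subtype_val.comp continuous_fst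
  have hN : Continuous fun p : unitInterval × OrdConf n threeStar => starNorm (p.2.1 j) :=
    (continuous_starNorm_apply j).comp continuous_snd
  by_cases hj : IsTame b (range f₀.1) (f₀.1 j)
  · refine ContinuousAt.congr (f := fun p : unitInterval × OrdConf n threeStar =>
      starPoint (starArm (f₀.1 j)) ((1 - p.1) * starNorm (p.2.1 j) +
        p.1 * spreadNorm n b 0 (range f₀.1) (f₀.1 j))) ?_ ?_
    · refine ((continuous_starPoint _).comp ?_).continuousAt
      fun_prop
    · filter_upwards [hev] with p hp
      rw [spread, hp.spreadNorm_eq p.2.2 f₀.2 hj, hp.starArm_eq j hj]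
  · rw [IsInducing.subtypeVal.continuousAt_iff]
    refine ContinuousAt.congr (f := fun p : unitInterval × OrdConf n threeStar =>
      (((1 - p.1 : ℝ) : ℂ) * (p.2.1 j : ℂ))) ?_ ?_
    · have : Continuous fun p : unitInterval × OrdConf n threeStar => (p.2.1 j : ℂ) :=
        continuous_subtype_val.comp
          ((continuous_apply j).comp (continuous_subtype_val.comp continuous_snd))
      fun_prop
    · filter_upwards [hev] with p hp
      rw [Function.comp_apply, spread, spreadNorm_of_not_isTame (mt (hp.isTame_iff j).1 hj), mul_zero, add_zero,
        coe_starPoint_mul _ (sub_nonneg.2 p.1.2.2) (sub_le_self _ p.1.2.1)]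

theorem continuousAt_spreadConf {s : UConf n threeStar} (h : s ∈ region n b α)
    (t₀ : unitInterval) :
    ContinuousAt (fun p : unitInterval × UConf n threeStar => spreadConf n b 0 p.2 p.1)
      (t₀, s) := by
  obtain ⟨f₀, rfl⟩ := confProj_surjective n threeStar s
  have hq : IsOpenQuotientMap (Prod.map id (confProj n threeStar) :
      unitInterval × OrdConf n threeStar → _) :=
    .prodMap .id ⟨confProj_surjective _ _, continuous_confProj _ _, isOpenMap_confProj _ _⟩
  have hε' : (0 : ℝ) < 1 / (n + 1) := by positivity
  classical
  let G (p : unitInterval × OrdConf n threeStar) : OrdConf n threeStar :=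
    if hp : Function.Injective fun j => spread n b 0 (range p.2.1) p.1 (p.2.1 j) then ⟨_, hp⟩
    else p.2
  have hG : ∀ᶠ p : unitInterval × OrdConf n threeStar in 𝓝 (t₀, f₀),
      ((G p).1 = fun j => spread n b 0 (range p.2.1) p.1 (p.2.1 j)) ∧
        confProj n threeStar (G p) = spreadConf n b 0 (confProj n threeStar p.2) p.1 := by
    have hev := (continuousAt_snd (p := (t₀, f₀))).eventually
      ((continuous_confProj n threeStar).continuousAt.eventually
        ((isOpen_region n b α).mem_nhds h))
    filter_upwards [hev] with p hp
    have hinj := injOn_spread_of_mem hp le_rfl hε' p.1.2.1 p.1.2.2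
    have hinj' : Function.Injective fun j => spread n b 0 (range p.2.1) p.1 (p.2.1 j) :=
      fun j k hjk => p.2.2 (hinj (mem_range_self j) (mem_range_self k) hjk)
    have h1 : G p = ⟨_, hinj'⟩ := dif_pos hinj'
    refine ⟨congrArg Subtype.val h1, Subtype.ext ?_⟩
    rw [h1, coe_spreadConf hinj]
    exact range_comp (spread n b 0 (range p.2.1) p.1) p.2.1
  have hGc : ContinuousAt G (t₀, f₀) := by
    refine IsInducing.subtypeVal.continuousAt_iff.2 ?_
    refine ContinuousAt.congr ?_ (hG.mono fun p hp => hp.1.symm)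
    exact continuousAt_pi.2 fun j => continuousAt_spread h t₀ j
  have hc : ContinuousAt ((fun p : unitInterval × UConf n threeStar => spreadConf n b 0 p.2 p.1) ∘
      Prod.map id (confProj n threeStar)) (t₀, f₀) :=
    ContinuousAt.congr ((continuous_confProj n threeStar).continuousAt.comp hGc)
      (hG.mono fun p hp => hp.2)
  exact hq.continuousAt_comp_iff.1 hc

theorem isSimplyConnected_region (hn : 1 ≤ n) (h : (region n b α).Nonempty) :
    IsSimplyConnected (region n b α) := by
  have hε' : (0 : ℝ) < 1 / (n + 1) := by positivity
  obtain ⟨s₀, hs₀⟩ := h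
  let H : ContinuousMap.Homotopy (ContinuousMap.id (region n b α)) (ContinuousMap.const _
      (⟨spreadConf n b 0 s₀ 1, spreadConf_mem hs₀ le_rfl hε' zero_le_one le_rfl⟩ :
        region n b α)) :=
    { toFun := fun p => ⟨spreadConf n b 0 p.2.1 p.1,
        spreadConf_mem p.2.2 le_rfl hε' p.1.2.1 p.1.2.2⟩
      continuous_toFun := by
        refine Continuous.subtype_mk (continuous_iff_continuousAt.2 fun p => ?_) _
        exact (continuousAt_spreadConf p.2.2 p.1).comp (f := fun p : unitInterval × region n b α =>
          (p.1, p.2.1)) (by fun_prop)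
      map_zero_left := fun s => Subtype.ext <| Subtype.ext <| by
        have hinj := injOn_spread_of_mem s.2 le_rfl hε' le_rfl zero_le_one
        change (spreadConf n b 0 s.1 (0 : ℝ)).1 = s.1.1
        rw [coe_spreadConf hinj]
        exact (image_congr fun z _ => spread_zero).trans (image_id _)
      map_one_left := fun s => Subtype.ext (spreadConf_one_eq hn s.2 hs₀) }
  have : ContractibleSpace (region n b α) :=
    (contractible_iff_id_nullhomotopic _).2 ⟨_, ⟨H⟩⟩
  exact SimplyConnectedSpace.ofContractible _

theorem spreadRadius_pos_of_pos (h : 0 < starNorm z) (hε : 0 < ε) (ht0 : 0 ≤ t) (ht1 : t ≤ 1) :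
    0 < spreadRadius n b ε s t z := by
  by_cases hz : IsTame b s z
  · exact spreadRadius_pos hz h ht0 ht1
  · simpa [spreadRadius, spreadNorm_of_not_isTame hz] using convex_lt h hε ht0 ht1

theorem spreadConf_mem_true {s : UConf n threeStar} (h : s ∈ region n True α)
    (h' : s ∈ region n False β) (hε : 0 < ε) (hε' : ε < 1 / (n + 1)) (ht0 : 0 ≤ t) (ht1 : t ≤ 1) :
    spreadConf n False ε s t ∈ region n True α := by
  have hinj := injOn_spread_of_mem h' hε.le hε' ht0 ht1
  have hpos : ∀ z ∈ s.1, 0 < spreadRadius n False ε s.1 t z := fun z hz =>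
    spreadRadius_pos_of_pos ((starNorm_nonneg z).lt_of_ne' (h.1 trivial z hz)) hε ht0 ht1
  unfold region
  rw [mem_ofPred_eq, coe_spreadConf hinj]
  refine ⟨?_, fun z _ w _ hz => absurd isTame_true hz, fun i => ?_⟩
  · rintro - _ ⟨z, hz, rfl⟩
    rw [starNorm_spread s.2.1 s.2.2 hz hε.le hε' ht0 ht1]
    exact (hpos z hz).ne'
  · rw [tameCount_image_spread s.2.1 s.2.2 hε' ht0 ht1 hinj
      (fun z _ => iff_of_true isTame_true isTame_true) fun z hz _ => hpos z hz, h.2.2]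

theorem joinedIn_spreadConf {s : UConf n threeStar} (h : s ∈ region n True α)
    (h' : s ∈ region n False β) (hε : 0 < ε) (hε' : ε < 1 / (n + 1)) :
    JoinedIn (region n True α ∩ region n False β) s (spreadConf n False ε s 1) := by
  have hinj := fun t : unitInterval => injOn_spread_of_mem h' hε.le hε' t.2.1 t.2.2
  have hc : Continuous fun t : unitInterval => spreadConf n False ε s t := by
    obtain ⟨f, rfl⟩ := confProj_surjective n threeStar s
    let G (t : unitInterval) : OrdConf n threeStar :=
      ⟨fun j => spread n False ε (range f.1) t (f.1 j), fun j k hjk =>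
        f.2 (hinj t (mem_range_self j) (mem_range_self k) hjk)⟩
    have hG : Continuous G := Continuous.subtype_mk (continuous_pi fun j =>
      (continuous_spread (f.1 j)).comp continuous_subtype_val) _
    convert (continuous_confProj n threeStar).comp hG using 1
    funext t
    refine Subtype.ext ?_
    rw [coe_spreadConf (hinj t)]
    exact (range_comp (spread n False ε (range f.1) t) f.1).symm
  refine ⟨⟨⟨fun t => spreadConf n False ε s t, hc⟩, ?_, rfl⟩, fun t =>
    ⟨spreadConf_mem_true h h' hε hε' t.2.1 t.2.2, spreadConf_mem h' hε.le hε' t.2.1 t.2.2⟩⟩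
  refine Subtype.ext ?_
  change (spreadConf n False ε s (0 : ℝ)).1 = s.1
  rw [coe_spreadConf (injOn_spread_of_mem h' hε.le hε' le_rfl zero_le_one)]
  exact (image_congr fun z _ => spread_zero).trans (image_id _)

theorem spreadConf_one_eq_of_mem_inter (hn : 1 ≤ n) {s s' : UConf n threeStar}
    (hε : 0 < ε) (hε' : ε < 1 / (n + 1)) (h : s ∈ region n True α ∩ region n False β)
    (h' : s' ∈ region n True α ∩ region n False β) :
    spreadConf n False ε s 1 = spreadConf n False ε s' 1 := by
  have hi := injOn_spread_of_mem h.2 hε.le hε' zero_le_one le_rfl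
  have hi' := injOn_spread_of_mem h'.2 hε.le hε' zero_le_one le_rfl
  obtain ⟨z, -, hzs, hz⟩ := exists_eq_add_single hn h.1 h.2
  obtain ⟨z', -, hzs', hz'⟩ := exists_eq_add_single hn h'.1 h'.2
  have harm : starArm z = starArm z' := by
    by_contra hne
    have h1 := congrFun (add_left_cancel (hz.symm.trans hz')) (starArm z)
    rw [Pi.single_eq_same, Pi.single_eq_of_ne hne] at h1
    exact one_ne_zero h1
  refine Subtype.ext ?_
  rw [coe_spreadConf hi, coe_spreadConf hi', image_spread_one s.2.1 h.2.2.2 hi,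
    image_spread_one s'.2.1 h'.2.2.2 hi', hzs, hzs', image_singleton, image_singleton, spread,
    spread, spreadNorm_of_not_isTame ((Set.ext_iff.1 hzs z).2 rfl).2,
    spreadNorm_of_not_isTame ((Set.ext_iff.1 hzs' z').2 rfl).2, harm]
  simp

theorem region_inter_nonempty (hβ : ∑ i, β i + 1 = n) (i₀ : Fin 3) :
    (region n True (β + Pi.single i₀ 1) ∩ region n False β).Nonempty := by
  have hn0 : (0 : ℝ) < n + 1 := by positivity
  let r : Option (Σ i, Fin (β i)) → ℝ
    | none => 1 / 2 / (n + 1)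
    | some p => ((p.2 : ℕ) + 1) / (n + 1)
  let a : Option (Σ i, Fin (β i)) → Fin 3
    | none => i₀
    | some p => p.1
  have r_lt : ∀ p, r none < r (some p) := fun p => by
    refine div_lt_div_of_pos_right ?_ hn0
    have : (0 : ℝ) ≤ (p.2 : ℕ) := Nat.cast_nonneg _
    linarith
  have r_pos : ∀ x, 0 < r x := by
    have : 0 < r none := by positivity
    rintro (_ | p)
    exacts [this, this.trans (r_lt p)]
  have r_le : ∀ x, r x ≤ 1 := by
    rintro (_ | p)
    · refine (div_le_one hn0).2 ?_
      linarith [(Nat.cast_nonneg n : (0 : ℝ) ≤ n)]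
    · refine (div_le_one hn0).2 ?_
      have h1 : β p.1 ≤ ∑ i, β i := Finset.single_le_sum (fun _ _ => Nat.zero_le _)
        (Finset.mem_univ _)
      have h2 : (p.2 : ℕ) ≤ n := by have := p.2.2; omega
      gcongr
  let g (x : Option (Σ i, Fin (β i))) : threeStar := starPoint (a x) (r x)
  have g_norm : ∀ x, starNorm (g x) = r x := fun x => starNorm_starPoint _ (r_pos x).le (r_le x)
  have g_arm : ∀ x, starArm (g x) = a x := fun x => starArm_starPoint _ (r_pos x) (r_le x)
  have g_inj : Function.Injective g := by
    intro x y hxy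
    have h1 : r x = r y := by rw [← g_norm, ← g_norm, hxy]
    have h2 : a x = a y := by rw [← g_arm, ← g_arm, hxy]
    rcases x with _ | ⟨i, x⟩ <;> rcases y with _ | ⟨j, y⟩
    · rfl
    · exact absurd h1 (r_lt _).ne
    · exact absurd h1 (r_lt _).ne'
    · obtain rfl : i = j := h2
      have h3 : ((x : ℕ) + 1 : ℝ) / (n + 1) = ((y : ℕ) + 1) / (n + 1) := h1
      rw [div_left_inj' hn0.ne', add_left_inj, Nat.cast_inj] at h3
      rw [Fin.ext h3]
  have g_tame : ∀ x, IsTame False (range g) (g x) ↔ x ≠ none := by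
    intro x
    simp only [IsTame, false_or, exists_range_iff, g_norm]
    rcases x with _ | p
    · simp only [ne_eq, not_true_eq_false, iff_false, not_exists, not_lt]
      rintro (_ | q)
      exacts [le_rfl, (r_lt q).le]
    · exact iff_of_true ⟨none, r_lt p⟩ (Option.some_ne_none p)
  have g_card : (range g).ncard = n := by
    rw [← image_univ, ncard_image_of_injective _ g_inj, ncard_univ, Nat.card_eq_fintype_card,
      Fintype.card_option, Fintype.card_sigma]
    simpa using hβ
  let s : UConf n threeStar := ⟨range g, finite_range g, g_card⟩
  have hF : s ∈ region n False β := by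
    refine ⟨False.elim, ?_, fun i => ?_⟩
    · rintro _ ⟨x, rfl⟩ _ ⟨y, rfl⟩ hx hy
      have hx' := not_not.1 (mt (g_tame x).2 hx)
      have hy' := not_not.1 (mt (g_tame y).2 hy)
      rw [hx', hy']
    · change {z ∈ range g | IsTame False (range g) z ∧ starArm z = i}.ncard = β i
      rw [ncard_sep_range g_inj]
      have : {x | IsTame False (range g) (g x) ∧ starArm (g x) = i} =
          range fun k : Fin (β i) => some (⟨i, k⟩ : Σ i, Fin (β i)) := by
        ext x
        simp only [g_tame, g_arm, mem_ofPred_eq, mem_range]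
        constructor
        · rcases x with _ | ⟨j, k⟩
          · exact fun h => absurd rfl h.1
          · rintro ⟨-, rfl⟩
            exact ⟨k, rfl⟩
        · rintro ⟨k, rfl⟩
          exact ⟨Option.some_ne_none _, rfl⟩
      rw [this, ← image_univ, ncard_image_of_injective _ fun k l hkl => by simpa using hkl,
        ncard_univ, Nat.card_eq_fintype_card, Fintype.card_fin]
  have hT : s ∈ region n True (tameCount True s.1) := by
    refine ⟨?_, fun z _ w _ hz => absurd isTame_true hz, fun _ => rfl⟩
    rintro - _ ⟨x, rfl⟩
    rw [g_norm]
    exact (r_pos x).ne'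
  obtain ⟨z, -, hzs, hz⟩ := exists_eq_add_single (by omega) hT hF
  have : g none = z := (Set.ext_iff.1 hzs (g none)).1
    ⟨(mem_range_self none : g none ∈ range g), mt (g_tame none).1 (not_not.2 rfl)⟩
  have harm : starArm z = i₀ := this ▸ g_arm none
  rw [hz, harm] at hT
  exact ⟨s, hT, hF⟩

theorem isPathConnected_region_inter (hβ : ∑ i, β i + 1 = n) {i₀ : Fin 3}
    (hα : α = β + Pi.single i₀ 1) : IsPathConnected (region n True α ∩ region n False β) := by
  subst hα
  have hε : (0 : ℝ) < 1 / 2 / (n + 1) := by positivity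
  have hε' : (1 / 2 / (n + 1) : ℝ) < 1 / (n + 1) := by gcongr; norm_num
  obtain ⟨s, hs⟩ := region_inter_nonempty hβ i₀
  refine ⟨s, hs, fun {s'} hs' => (joinedIn_spreadConf hs.1 hs.2 hε hε').trans ?_⟩
  rw [spreadConf_one_eq_of_mem_inter (by omega) hε hε' hs hs']
  exact (joinedIn_spreadConf hs'.1 hs'.2 hε hε').symm

theorem mem_region_true_or_false (s : UConf n threeStar) :
    s ∈ region n True (tameCount True s.1) ∨ s ∈ region n False (tameCount False s.1) := by
  by_cases h : ∀ z ∈ s.1, starNorm z ≠ 0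
  · exact .inl ⟨fun _ => h, fun z _ w _ hz => absurd isTame_true hz, fun _ => rfl⟩
  · push Not at h
    obtain ⟨z₀, hz₀, h0⟩ := h
    refine .inr ⟨False.elim, ?_, fun _ => rfl⟩
    have key : ∀ z, ¬IsTame False s.1 z → z = starPoint 0 0 := by
      intro z hz
      have h1 : starNorm z = 0 := by
        refine le_antisymm ?_ (starNorm_nonneg z)
        by_contra! h1
        exact hz (.inr ⟨z₀, hz₀, h0 ▸ h1⟩)
      rw [← starPoint_starArm z, h1, starPoint_zero]
    intro z _ w _ hz hw
    rw [key z hz, key w hw]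

theorem eq_of_mem_region {s : UConf n threeStar} (h : s ∈ region n b α)
    (h' : s ∈ region n b β) : α = β :=
  funext fun i => (h.2.2 i).symm.trans (h'.2.2 i)

end Regions

/-- The free generators are indexed by a set with `n.choose 2` elements. -/
theorem nonempty_equiv_fin_choose_two (n : ℕ) :
    Nonempty ({p : ℕ × ℕ // 1 ≤ p.1 ∧ p.1 + p.2 < n} ≃ Fin (n.choose 2)) := by
  let e : {p : ℕ × ℕ // 1 ≤ p.1 ∧ p.1 + p.2 < n} ≃ Σ m : Fin n, Fin m :=
    { toFun := fun p => ⟨⟨p.1.1 + p.1.2, p.2.2⟩, ⟨p.1.2, by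
        have := p.2.1
        change p.1.2 < p.1.1 + p.1.2
        omega⟩⟩
      invFun := fun q => ⟨(q.1 - q.2, q.2), by
        have h1 := q.1.2
        have h2 := q.2.2
        exact ⟨by omega, by omega⟩⟩
      left_inv := fun p => by
        ext <;> simp
      right_inv := fun q => by
        obtain ⟨⟨m, hm⟩, ⟨k, hk⟩⟩ := q
        have hk' : k < m := hk
        have : m - k + k = m := by omega
        simp only
        congr! 2 }
  refine ⟨e.trans (Fintype.equivFinOfCardEq ?_)⟩
  rw [Fintype.card_sigma]
  simp only [Fintype.card_fin]
  rw [Fin.sum_univ_eq_sum_range (fun m => m), Finset.sum_range_id, Nat.choose_two_right]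

/-- the n-string braid group of the 3-star `S₃` is free of rank `n choose 2`. -/
theorem braid_threeStar_free (n : ℕ) (hn : 1 ≤ n) (c : UConf n ↥threeStar) :
    Nonempty (FundamentalGroup (UConf n ↥threeStar) c ≃* FreeGroup (Fin (n.choose 2))) := by
  have sumA : ∀ {s : UConf n threeStar} {α}, s ∈ region n True α → α 0 + α 1 + α 2 = n :=
    fun h => by rw [← Fin.sum_univ_three]; exact sum_of_mem_region_true h
  have sumB : ∀ {s : UConf n threeStar} {β}, s ∈ region n False β → β 0 + β 1 + β 2 + 1 = n :=
    fun h => by rw [← Fin.sum_univ_three]; exact sum_of_mem_region_false hn h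
  have h₀ : ∀ a c, a + c < n → IsPathConnected
      (region n True ![a + 1, n - (a + 1) - c, c] ∩ region n False ![a, n - 1 - a - c, c]) := by
    intro a c h
    refine isPathConnected_region_inter (i₀ := 0) (by simp [Fin.sum_univ_three]; omega) ?_
    ext j
    fin_cases j <;> simp
    omega
  have h₁ : ∀ a c, a + c < n → IsPathConnected
      (region n True ![a, n - a - c, c] ∩ region n False ![a, n - 1 - a - c, c]) := by
    intro a c h
    refine isPathConnected_region_inter (i₀ := 1) (by simp [Fin.sum_univ_three]; omega) ?_
    ext j
    fin_cases j <;> simp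
    omega
  have h₂ : ∀ a c, a + c < n → IsPathConnected
      (region n True ![a, n - a - (c + 1), c + 1] ∩ region n False ![a, n - 1 - a - c, c]) := by
    intro a c h
    refine isPathConnected_region_inter (i₀ := 2) (by simp [Fin.sum_univ_three]; omega) ?_
    ext j
    fin_cases j <;> simp
    omega
  obtain ⟨φ⟩ := nonempty_mulEquiv_freeGroup_of_triangular_cover n
    (fun a c => region n True ![a, n - a - c, c]) (fun a c => region n False ![a, n - 1 - a - c, c])
    (fun _ _ => isOpen_region _ _ _) (fun _ _ => isOpen_region _ _ _)
    (fun s => by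
      rcases mem_region_true_or_false s with h | h
      · generalize tameCount True s.1 = α at h
        have hα : α = ![α 0, n - α 0 - α 2, α 2] := by
          have := sumA h
          ext j
          fin_cases j <;> simp
          omega
        rw [hα] at h
        exact .inl ⟨_, _, h⟩
      · generalize tameCount False s.1 = β at h
        have hβ : β = ![β 0, n - 1 - β 0 - β 2, β 2] := by
          have := sumB h
          ext j
          fin_cases j <;> simp
          omega
        rw [hβ] at h
        exact .inr ⟨_, _, h⟩)
    (fun a c h => by
      refine isSimplyConnected_region hn ?_
      rcases h.lt_or_eq with h | h
      · exact (h₁ a c h).nonempty.mono inter_subset_left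
      · rcases a with _ | a
        · obtain ⟨c, rfl⟩ : ∃ c', c = c' + 1 := ⟨c - 1, by omega⟩
          exact (h₂ 0 c (by omega)).nonempty.mono inter_subset_left
        · exact (h₀ a c (by omega)).nonempty.mono inter_subset_left)
    (fun a c h => isSimplyConnected_region hn ((h₁ a c h).nonempty.mono inter_subset_right))
    (fun a c ⟨s, hs⟩ => by
      have := sumA hs
      simp at this
      omega)
    (fun a c ⟨s, hs⟩ => by
      have := sumB hs
      simp at this
      omega)
    (fun a c a' c' ⟨s, hs, hs'⟩ => by
      have := eq_of_mem_region hs hs'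
      exact ⟨congrFun this 0, congrFun this 2⟩)
    (fun a c a' c' ⟨s, hs, hs'⟩ => by
      have := eq_of_mem_region hs hs'
      exact ⟨congrFun this 0, congrFun this 2⟩)
    (fun a c a' c' ⟨s, hs, hs'⟩ => by
      obtain ⟨z, -, -, h⟩ := exists_eq_add_single hn hs hs'
      have e0 := congrFun h 0
      have e2 := congrFun h 2
      generalize starArm z = i at e0 e2
      fin_cases i <;> simp at e0 e2 <;> omega)
    h₀ h₁ h₂ c
  obtain ⟨e⟩ := nonempty_equiv_fin_choose_two n
  exact ⟨φ.trans (FreeGroup.freeGroupCongr e)⟩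

end
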